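/- arXiv:1207.5258 — 2 statements merged into one kernel-verified Lean document; each statement's English description precedes it below -/
import Mathlib

section
/- Let Q ⊆ ℝⁿ be a closed set, f : ℝⁿ → ℝ a continuous function, ε : ℝⁿ → (0,∞) a continuous function, and let 𝒜 be a C²-stratification of Q consisting of m strata. Then there exists a Fréchet differentiable function g : ℝⁿ → ℝ satisfying simultaneously: (uniform closeness) |f(x) − g(x)| < ε(x) for all x ∈ ℝⁿ; (boundary condition) for every stratum M ∈ 𝒜 and every x ∈ M, the gradient ∇g(x) lies in the tangent space T_xM; (Lipschitz modulus) if f is κ-Lipschitz then g can be chosen to be 13^{m+1}·κ-Lipschitz; (support) given any open neighborhood V₁ of the support of f, g can be chosen with support contained in V₁. -/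
open Filter Topology Metric

noncomputable section

/-- `M ⊆ ℝⁿ` is a `C^p` manifold of dimension `d`: around each of its points it is the zero
set of a `C^p` map into `ℝ^(n-d)` whose derivative is surjective. -/
def IsCpManifold (n : ℕ) (p : ℕ∞) (d : ℕ) (M : Set (EuclideanSpace ℝ (Fin n))) : Prop :=
  ∀ x ∈ M, ∃ (U : Set (EuclideanSpace ℝ (Fin n)))
    (F : EuclideanSpace ℝ (Fin n) → EuclideanSpace ℝ (Fin (n - d))),
    IsOpen U ∧ x ∈ U ∧ ContDiffOn ℝ p F U ∧ M ∩ U = U ∩ F ⁻¹' {0} ∧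
      Function.Surjective (fderiv ℝ F x)

/-- The tangent space of `M` at `x`: the linear span of the tangent cone. -/
def tangentSp (n : ℕ) (M : Set (EuclideanSpace ℝ (Fin n))) (x : EuclideanSpace ℝ (Fin n)) :
    Submodule ℝ (EuclideanSpace ℝ (Fin n)) :=
  Submodule.span ℝ (tangentConeAt ℝ M x)

/-- The normal space of `M` at `x`: the orthogonal complement of the tangent space. -/
def normalSp (n : ℕ) (M : Set (EuclideanSpace ℝ (Fin n))) (x : EuclideanSpace ℝ (Fin n)) :
    Submodule ℝ (EuclideanSpace ℝ (Fin n)) :=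
  (tangentSp n M x)ᗮ

/-- A `C^p`-stratification of `Q ⊆ ℝⁿ`: a partition of `Q` into finitely many `C^p` manifolds
satisfying the frontier condition, with the dimension decreasing along frontiers. -/
structure CpStratification (n : ℕ) (p : ℕ∞) (Q : Set (EuclideanSpace ℝ (Fin n))) where
  strata : Finset (Set (EuclideanSpace ℝ (Fin n)))
  dim : Set (EuclideanSpace ℝ (Fin n)) → ℕ
  isManifold : ∀ M ∈ strata, IsCpManifold n p (dim M) M
  covers : ⋃₀ (strata : Set (Set (EuclideanSpace ℝ (Fin n)))) = Q
  pairwiseDisjoint : ∀ M ∈ strata, ∀ L ∈ strata, M ≠ L → Disjoint M L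
  frontierCond : ∀ L ∈ strata, ∀ M ∈ strata, L ≠ M → (L ∩ closure M).Nonempty →
    L ⊆ closure M \ M
  dim_lt : ∀ L ∈ strata, ∀ M ∈ strata, L ≠ M → L ⊆ closure M \ M → dim L < dim M

/-- A countable family of compactly supported `C¹` maps can be weighted so that all series with
smaller weights converge in `C¹`, with small derivative. -/
lemma exists_weights {ι E G : Type*} [Countable ι] [NormedAddCommGroup E] [NormedSpace ℝ E]
    [NormedAddCommGroup G] [NormedSpace ℝ G] [CompleteSpace G]
    (h : ι → E → G) (hh : ∀ i, ContDiff ℝ 1 (h i)) (hcs : ∀ i, HasCompactSupport (h i))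
    {c : ℝ} (hc : 0 < c) :
    ∃ a : ι → ℝ, (∀ i, 0 < a i) ∧ ∀ w : ι → ℝ, (∀ i, 0 ≤ w i) → (∀ i, w i ≤ a i) →
      (∀ x, Summable fun i => w i • h i x) ∧
      (∀ x, Summable fun i => w i • fderiv ℝ (h i) x) ∧
      (∀ x, HasFDerivAt (fun x => ∑' i, w i • h i x) (∑' i, w i • fderiv ℝ (h i) x) x) ∧
      (Continuous fun x => ∑' i, w i • fderiv ℝ (h i) x) ∧
      ∀ x, ‖∑' i, w i • fderiv ℝ (h i) x‖ ≤ c := by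
  have := Encodable.ofCountable ι
  obtain ⟨b, hb0, c', hbc, hc'⟩ := posSumOfEncodable hc ι
  have hB : ∀ i, ∃ B : ℝ, 0 < B ∧ (∀ x, ‖h i x‖ ≤ B) ∧ ∀ x, ‖fderiv ℝ (h i) x‖ ≤ B := by
    intro i
    obtain ⟨B₁, hB₁⟩ := (hcs i).exists_bound_of_continuous (hh i).continuous
    obtain ⟨B₂, hB₂⟩ := ((hcs i).fderiv ℝ).exists_bound_of_continuous
      ((hh i).continuous_fderiv one_ne_zero)
    refine ⟨max 1 (max B₁ B₂), by positivity, fun x => (hB₁ x).trans ?_, fun x =>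
      (hB₂ x).trans ?_⟩ <;> simp
  choose B hB0 hB1 hB2 using hB
  refine ⟨fun i => b i / B i, fun i => div_pos (hb0 i) (hB0 i), fun w hw0 hw => ?_⟩
  have key1 : ∀ i x, ‖w i • h i x‖ ≤ b i := fun i x => by
    rw [norm_smul, Real.norm_of_nonneg (hw0 i)]
    exact (mul_le_mul (hw i) (hB1 i x) (norm_nonneg _) (div_pos (hb0 i) (hB0 i)).le).trans_eq
      (div_mul_cancel₀ _ (hB0 i).ne')
  have key2 : ∀ i x, ‖w i • fderiv ℝ (h i) x‖ ≤ b i := fun i x => by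
    rw [norm_smul, Real.norm_of_nonneg (hw0 i)]
    exact (mul_le_mul (hw i) (hB2 i x) (norm_nonneg _) (div_pos (hb0 i) (hB0 i)).le).trans_eq
      (div_mul_cancel₀ _ (hB0 i).ne')
  have s1 : ∀ x, Summable fun i => w i • h i x := fun x =>
    Summable.of_norm_bounded hbc.summable fun i => key1 i x
  refine ⟨s1, fun x => Summable.of_norm_bounded hbc.summable fun i => key2 i x, fun x => ?_, ?_,
    fun x => (tsum_of_norm_bounded hbc fun i => key2 i x).trans hc'⟩
  · exact hasFDerivAt_tsum (x₀ := 0) hbc.summable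
      (fun i x => (((hh i).differentiable one_ne_zero x).hasFDerivAt).const_smul (w i))
      (fun i x => key2 i x) (s1 0) x
  · exact continuous_tsum (fun i => ((hh i).continuous_fderiv one_ne_zero).const_smul (w i))
      hbc.summable key2

/-- An open set is the support of a nonnegative `C¹` function that is small in `C¹` sense. -/
lemma exists_small_contDiff {E : Type*} [NormedAddCommGroup E] [InnerProductSpace ℝ E]
    [FiniteDimensional ℝ E] {O : Set E} (hO : IsOpen O) {e : E → ℝ} (he : ContinuousOn e O)
    (he0 : ∀ x ∈ O, 0 < e x) {c : ℝ} (hc : 0 < c) :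
    ∃ ρ : E → ℝ, ContDiff ℝ 1 ρ ∧ (∀ x, 0 ≤ ρ x) ∧ (∀ x ∈ O, 0 < ρ x ∧ ρ x ≤ e x) ∧
      (∀ x ∉ O, ρ x = 0) ∧ ∀ x, ‖fderiv ℝ ρ x‖ ≤ c := by
  have hball : ∀ x : O, ∃ r : ℝ, 0 < r ∧ closedBall (x : E) r ⊆ O := fun x =>
    nhds_basis_closedBall.mem_iff.1 (hO.mem_nhds x.2)
  choose r hr0 hrO using hball
  let χ : ∀ x : O, ContDiffBump (x : E) := fun x => ⟨r x / 2, r x, half_pos (hr0 x),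
    half_lt_self (hr0 x)⟩
  obtain ⟨T, hTc, hT⟩ := TopologicalSpace.isOpen_iUnion_countable
    (fun x : O => ball (x : E) (r x)) fun _ => isOpen_ball
  have : Countable T := hTc
  obtain ⟨a, ha0, ha⟩ := exists_weights (fun (i : T) => (χ i : E → ℝ)) (fun i => (χ i).contDiff)
    (fun i => (χ i).hasCompactSupport) hc
  have := Encodable.ofCountable T
  obtain ⟨b, hb0, c', hbc, hc'⟩ := posSumOfEncodable one_pos T
  have hmin : ∀ i : T, ∃ μ : ℝ, 0 < μ ∧ ∀ y ∈ closedBall ((i : O) : E) (r i), μ ≤ e y := by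
    intro i
    obtain ⟨z, hz, hz'⟩ := (isCompact_closedBall ((i : O) : E) (r i)).exists_isMinOn
      ⟨_, mem_closedBall_self (hr0 i).le⟩ (he.mono (hrO i))
    exact ⟨e z, he0 _ (hrO i hz), fun y hy => hz' hy⟩
  choose μ hμ0 hμ using hmin
  let w : T → ℝ := fun i => min (a i) (b i * μ i)
  have hw0 : ∀ i, 0 < w i := fun i => lt_min (ha0 i) (mul_pos (hb0 i) (hμ0 i))
  obtain ⟨h1, h2, h3, h4, h5⟩ := ha w (fun i => (hw0 i).le) fun i => min_le_left _ _
  have hterm : ∀ x i, 0 ≤ w i • χ (i : O) x := fun x i =>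
    mul_nonneg (hw0 i).le (χ (i : O)).nonneg
  refine ⟨fun x => ∑' i, w i • χ (i : O) x, contDiff_one_iff_hasFDerivAt.2 ⟨_, h4, h3⟩,
    fun x => tsum_nonneg (hterm x), fun x hx => ⟨?_, ?_⟩, fun x hx => ?_, fun x => ?_⟩
  · have : x ∈ ⋃ i ∈ T, ball ((i : O) : E) (r i) := by
      rw [hT]
      exact Set.mem_iUnion.2 ⟨⟨x, hx⟩, mem_ball_self (hr0 _)⟩
    obtain ⟨i, hiT, hi⟩ := Set.mem_iUnion₂.1 this
    refine (h1 x).tsum_pos (hterm x) ⟨i, hiT⟩ (mul_pos (hw0 _) ((χ i).pos_of_mem_ball hi))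
  · have hle : ∀ i, w i • χ (i : O) x ≤ b i * e x := by
      intro i
      by_cases hi : x ∈ closedBall ((i : O) : E) (r i)
      · calc w i • χ (i : O) x ≤ (b i * μ i) * 1 :=
              mul_le_mul (min_le_right _ _) (χ (i : O)).le_one (χ (i : O)).nonneg
                (mul_pos (hb0 i) (hμ0 i)).le
          _ ≤ b i * e x := by
              rw [mul_one]; exact mul_le_mul_of_nonneg_left (hμ i x hi) (hb0 i).le
      · have : χ (i : O) x = 0 := (χ (i : O)).zero_of_le_dist (by
          rw [mem_closedBall, not_le] at hi; exact hi.le)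
        rw [this, smul_zero]
        exact mul_nonneg (hb0 i).le (he0 x hx).le
    calc ∑' i, w i • χ (i : O) x ≤ ∑' i, b i * e x :=
          (h1 x).tsum_le_tsum hle (hbc.summable.mul_right _)
      _ = c' * e x := by rw [tsum_mul_right, hbc.tsum_eq]
      _ ≤ e x := mul_le_of_le_one_left (he0 x hx).le hc'
  · have : ∀ i : T, w i • χ (i : O) x = 0 := fun i => by
      rw [(χ (i : O)).zero_of_le_dist, smul_zero]
      by_contra hlt
      exact hx (hrO i (le_of_not_ge hlt))
    simp only [this, tsum_zero]
  · rw [(h3 x).fderiv]; exact h5 x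

/-- A continuous map has a continuous pointwise modulus of continuity. -/
lemma exists_modulus {E Y : Type*} [MetricSpace E] [PseudoMetricSpace Y]
    {F : E → Y} (hF : Continuous F) {η : E → ℝ} (hη : Continuous η) (hη0 : ∀ x, 0 < η x) :
    ∃ δ : E → ℝ, Continuous δ ∧ (∀ x, 0 < δ x) ∧
      ∀ x y, dist y x < δ x → dist (F y) (F x) < η x := by
  let t : E → Set ℝ := fun x => {d | 0 < d ∧ ∀ y, dist y x < d → dist (F y) (F x) < η x}
  have ht : ∀ x, Convex ℝ (t x) := fun x =>
    Set.OrdConnected.convex ⟨fun a ha b hb d hd => ⟨ha.1.trans_le hd.1, fun y hy =>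
      hb.2 y (hy.trans_le hd.2)⟩⟩
  have hloc : ∀ x, ∃ d, ∀ᶠ y in 𝓝 x, d ∈ t y := by
    intro x
    have h1 : ∀ᶠ y in 𝓝 x, dist (F y) (F x) < η x / 4 :=
      (hF.tendsto x).eventually (ball_mem_nhds _ (by linarith [hη0 x]))
    have h2 : ∀ᶠ y in 𝓝 x, η x / 2 < η y :=
      (hη.tendsto x).eventually (lt_mem_nhds (half_lt_self (hη0 x)))
    obtain ⟨d, hd0, hd⟩ := Metric.eventually_nhds_iff.1 (h1.and h2)
    refine ⟨d / 2, Metric.eventually_nhds_iff.2 ⟨d / 2, half_pos hd0, fun y hy =>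
      ⟨half_pos hd0, fun z hz => ?_⟩⟩⟩
    have hy' := hd (hy.trans (half_lt_self hd0))
    have hz' := hd (lt_of_le_of_lt (dist_triangle z y x) (by linarith))
    linarith [dist_triangle_right (F z) (F y) (F x)]
  obtain ⟨g, hg⟩ := exists_continuous_forall_mem_convex_of_local_const ht hloc
  exact ⟨g, g.continuous, fun x => (hg x).1, fun x => (hg x).2⟩

open MeasureTheory in
/-- Mollification of a continuous function with variable radius. -/
lemma exists_mollification {E : Type*} [NormedAddCommGroup E] [InnerProductSpace ℝ E]
    [FiniteDimensional ℝ E] [MeasurableSpace E] [BorelSpace E]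
    {f r : E → ℝ} (hf : Continuous f) (hr : ContDiff ℝ 1 r)
    (hr0 : ∀ x, 0 < r x) (hr1 : ∀ x, r x ≤ 1) (hrL : LipschitzWith 1 r) :
    ∃ f₀ : E → ℝ, Differentiable ℝ f₀ ∧
      (∀ x a t, (∀ y, dist y x ≤ r x → |f y - a| ≤ t) → |f₀ x - a| ≤ t) ∧
      ∀ κ : NNReal, LipschitzWith κ f → LipschitzWith (2 * κ) f₀ := by
  let φ : ContDiffBump (0 : E) := ⟨1 / 2, 1, by norm_num, by norm_num⟩
  let w : E → ℝ := φ.normed volume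
  have hw0 : ∀ z, 0 ≤ w z := φ.nonneg_normed
  have hw1 : ∫ z, w z = 1 := φ.integral_normed
  have hwc : Continuous w := φ.continuous_normed
  have hwd : ContDiff ℝ 1 w := φ.contDiff_normed
  have hws : HasCompactSupport w := φ.hasCompactSupport_normed
  have hwz : ∀ z, 1 ≤ ‖z‖ → w z = 0 := fun z hz => by
    by_contra h
    have : z ∈ Function.support w := h
    rw [φ.support_normed_eq, mem_ball_zero_iff] at this
    exact absurd hz (not_le.2 this)
  have hwu : ∀ u : E → ℝ, Continuous u → Integrable fun z => w z * u z := fun u hu =>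
    (hwc.mul hu).integrable_of_hasCompactSupport hws.mul_right
  have hwint : Integrable w := hwc.integrable_of_hasCompactSupport hws
  have hbound : ∀ u : E → ℝ, ∀ t, (∀ z, ‖z‖ ≤ 1 → |u z| ≤ t) → |∫ z, w z * u z| ≤ t := by
    intro u t hu
    calc |∫ z, w z * u z| ≤ ∫ z, w z * t := by
          refine norm_integral_le_of_norm_le (f := fun z => w z * u z) (hwint.mul_const t)
            (ae_of_all _ fun z => ?_)
          rw [norm_mul, Real.norm_of_nonneg (hw0 z)]
          rcases le_total 1 ‖z‖ with hz | hz
          · simp [hwz z hz]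
          · exact mul_le_mul_of_nonneg_left (hu z hz) (hw0 z)
      _ = t := by rw [integral_mul_const, hw1, one_mul]
  have hcx : ∀ x, Continuous fun z => f (x - r x • z) := fun x => by fun_prop
  refine ⟨fun x => ∫ z, w z * f (x - r x • z), ?_, fun x a t h => ?_, fun κ hκ => ?_⟩
  · have hconv : ContDiffOn ℝ (1 : ℕ∞) (fun x => convolution f (fun y => w ((r x)⁻¹ • y))
        (ContinuousLinearMap.mul ℝ ℝ) volume (id x)) Set.univ := by
      refine contDiffOn_convolution_right_with_param_comp (P := E) (G := E)
        (ContinuousLinearMap.mul ℝ ℝ) (v := id) contDiffOn_id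
        (g := fun x y => w ((r x)⁻¹ • y)) isOpen_univ (isCompact_closedBall 0 1)
        (fun p x _ hx => hwz _ ?_) hf.locallyIntegrable ?_
      · rw [mem_closedBall_zero_iff, not_le] at hx
        rw [norm_smul, norm_inv, Real.norm_of_nonneg (hr0 p).le, ← div_eq_inv_mul,
          le_div_iff₀ (hr0 p)]
        linarith [hr1 p]
      · refine ContDiff.contDiffOn ?_
        refine hwd.comp (ContDiff.smul (ContDiff.inv (hr.comp contDiff_fst)
          fun x => (hr0 x.1).ne') contDiff_snd)
    have heq : (fun x => ∫ z, w z * f (x - r x • z)) = fun x =>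
        ((r x) ^ Module.finrank ℝ E)⁻¹ * convolution f (fun y => w ((r x)⁻¹ • y))
        (ContinuousLinearMap.mul ℝ ℝ) volume (id x) := by
      funext x
      have hrx := (hr0 x).ne'
      have h1 : convolution f (fun y => w ((r x)⁻¹ • y)) (ContinuousLinearMap.mul ℝ ℝ) volume
          (id x) = ∫ t, (fun z => w z * f (x - r x • z)) ((r x)⁻¹ • t) := by
        rw [convolution_def, ← integral_sub_left_eq_self _ volume x]
        refine integral_congr_ae (ae_of_all _ fun t => ?_)
        simp [smul_smul, hrx, mul_comm]
      rw [h1, Measure.integral_comp_inv_smul volume (fun z => w z * f (x - r x • z)) (r x),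
        abs_of_pos (pow_pos (hr0 x) _), smul_eq_mul,
        inv_mul_cancel_left₀ (pow_pos (hr0 x) _).ne']
    rw [heq]
    have h2 := (contDiffOn_univ.1 hconv).differentiable (by simp)
    exact (((hr.differentiable one_ne_zero).pow _).inv fun x => (pow_pos (hr0 x) _).ne').mul h2
  · have : (∫ z, w z * f (x - r x • z)) - a = ∫ z, w z * (f (x - r x • z) - a) := by
      simp_rw [mul_sub]
      rw [integral_sub (hwu _ (hcx x)) (hwint.mul_const a), integral_mul_const, hw1, one_mul]
    rw [this]
    refine hbound _ _ fun z hz => h _ ?_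
    rw [dist_eq_norm, sub_sub_cancel_left, norm_neg, norm_smul, Real.norm_of_nonneg (hr0 x).le]
    exact mul_le_of_le_one_right (hr0 x).le hz
  · refine LipschitzWith.of_dist_le_mul fun x y => ?_
    have : (∫ z, w z * f (x - r x • z)) - (∫ z, w z * f (y - r y • z)) =
        ∫ z, w z * (f (x - r x • z) - f (y - r y • z)) := by
      simp_rw [mul_sub]
      rw [integral_sub (hwu _ (hcx x)) (hwu _ (hcx y))]
    rw [Real.dist_eq, this]
    refine hbound _ _ fun z hz => ?_
    rw [← Real.dist_eq]
    refine (hκ.dist_le_mul _ _).trans ?_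
    have h1 : dist (x - r x • z) (y - r y • z) ≤ dist x y + dist x y := by
      refine (dist_sub_sub_le _ _ _ _).trans (add_le_add le_rfl ?_)
      rw [dist_eq_norm, ← sub_smul, norm_smul, ← dist_eq_norm]
      refine (mul_le_of_le_one_right dist_nonneg hz).trans ?_
      simpa using hrL.dist_le_mul x y
    calc (κ : ℝ) * dist (x - r x • z) (y - r y • z) ≤ κ * (dist x y + dist x y) :=
          mul_le_mul_of_nonneg_left h1 κ.2
      _ = _ := by push_cast; ring

/-- Kernel vectors of the derivative of a submersion are tangent to its level set. -/
lemma mem_tangentConeAt_of_fderiv_eq_zero {E K : Type*} [NormedAddCommGroup E] [NormedSpace ℝ E]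
    [CompleteSpace E] [NormedAddCommGroup K] [NormedSpace ℝ K] [FiniteDimensional ℝ K]
    {M U : Set E} {F : E → K} {D : E →L[ℝ] K} {x v : E} (hU : U ∈ 𝓝 x)
    (hM : ∀ y ∈ U, F y = F x → y ∈ M) (hF : HasStrictFDerivAt F D x)
    (hD : Function.Surjective D) (hv : D v = 0) : v ∈ tangentConeAt ℝ M x := by
  have hr : D.range = ⊤ := LinearMap.range_eq_top.2 hD
  let v' : D.ker := ⟨v, hv⟩
  let γ : ℝ → E := fun t => hF.implicitFunction F D hr (F x) (t • v')
  have hγ0 : γ 0 = x := by simp [γ]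
  have hline : HasDerivAt (fun t : ℝ => t • v') v' 0 := by
    simpa using (hasDerivAt_id (0 : ℝ)).smul_const v'
  have hγ : HasDerivAt γ v 0 := by
    have h1 : HasFDerivAt (hF.implicitFunction F D hr (F x)) D.ker.subtypeL ((0 : ℝ) • v') := by
      rw [zero_smul]; exact (hF.to_implicitFunction hr).hasFDerivAt
    exact h1.comp_hasDerivAt 0 hline
  have ht0 : Tendsto (fun t : ℝ => t • v') (𝓝 0) (𝓝 0) := by
    simpa using hline.continuousAt.tendsto
  have hev : ∀ᶠ t in 𝓝 (0 : ℝ), F (γ t) = F x :=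
    (Tendsto.prodMk_nhds (tendsto_const_nhds (x := F x)) ht0).eventually
      (hF.map_implicitFunction_eq hr)
  have hγt : Tendsto γ (𝓝 0) (𝓝 x) := by simpa only [hγ0] using hγ.continuousAt.tendsto
  refine mem_tangentConeAt_of_seq (𝓝[≠] (0 : ℝ)) (fun t => t⁻¹) (fun t => γ t - x) ?_ ?_ ?_
  · have := (hγt.sub_const x).mono_left (nhdsWithin_le_nhds (s := {0}ᶜ))
    simpa using this
  · refine nhdsWithin_le_nhds ?_
    filter_upwards [hev, hγt.eventually hU] with t h1 h2
    rw [add_sub_cancel]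
    exact hM _ h2 h1
  · have := hasDerivAt_iff_tendsto_slope_zero.1 hγ
    simpa only [zero_add, hγ0] using this

/-- Near a point of a level set of a `C²` submersion there is a `C¹` map vanishing on the level
set whose derivative there is the orthogonal projection to the normal space. -/
lemma exists_local_normal_map {E K : Type*} [NormedAddCommGroup E] [InnerProductSpace ℝ E]
    [FiniteDimensional ℝ E] [NormedAddCommGroup K] [InnerProductSpace ℝ K] [FiniteDimensional ℝ K]
    {M U : Set E} {F : E → K} {x₀ : E} (hU : IsOpen U) (hx₀ : x₀ ∈ U) (hF : ContDiffOn ℝ 2 F U)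
    (hM : M ∩ U = U ∩ F ⁻¹' {0}) (hs : Function.Surjective (fderiv ℝ F x₀)) :
    ∃ (V : Set E) (ψ : E → E), IsOpen V ∧ x₀ ∈ V ∧ ContDiffOn ℝ 1 ψ V ∧
      ∀ x ∈ M ∩ V, ψ x = 0 ∧ ‖fderiv ℝ ψ x‖ ≤ 1 ∧
        ∀ v ∈ (Submodule.span ℝ (tangentConeAt ℝ M x))ᗮ, fderiv ℝ ψ x v = v := by
  let adj : (E →L[ℝ] K) →L[ℝ] (K →L[ℝ] E) := LinearMap.mkContinuous
    { toFun := fun T => ContinuousLinearMap.adjoint T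
      map_add' := fun S T => by simp
      map_smul' := fun c T => by simp } 1 fun T => by simp
  have hadj : ∀ T u y, inner ℝ (adj T y) u = inner ℝ y (T u) := fun T u y =>
    ContinuousLinearMap.adjoint_inner_left T u y
  have hD : ContDiffOn ℝ 1 (fderiv ℝ F) U := hF.fderiv_of_isOpen hU (by norm_num)
  let B : E → K →L[ℝ] K := fun x => (fderiv ℝ F x).comp (adj (fderiv ℝ F x))
  have hB : ContDiffOn ℝ 1 B U := hD.clm_comp (adj.contDiff.comp_contDiffOn hD)
  let V : Set E := U ∩ B ⁻¹' {T | IsUnit T}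
  have hVo : IsOpen V := hB.continuousOn.isOpen_inter_preimage hU Units.isOpen
  let A : E → K →L[ℝ] E := fun x => (adj (fderiv ℝ F x)).comp (Ring.inverse (B x))
  have hA : ContDiffOn ℝ 1 A V := by
    refine ContDiffOn.clm_comp (adj.contDiff.comp_contDiffOn (hD.mono Set.inter_subset_left)) ?_
    intro x hx
    obtain ⟨u, hu⟩ := hx.2
    have h1 : ContDiffAt ℝ 1 Ring.inverse (B x) := by
      rw [← hu]; exact contDiffAt_ringInverse ℝ u
    exact h1.comp_contDiffWithinAt x ((hB x hx.1).mono Set.inter_subset_left)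
  refine ⟨V, fun x => A x (F x), hVo, ⟨hx₀, ?_⟩,
    hA.clm_apply ((hF.of_le (by norm_num)).mono Set.inter_subset_left), ?_⟩
  · have hinj : Function.Injective (B x₀) := by
      refine (injective_iff_map_eq_zero _).2 fun y hy => ?_
      have h1 : adj (fderiv ℝ F x₀) y = 0 := by
        rw [← inner_self_eq_zero (𝕜 := ℝ), hadj]
        change inner ℝ y (B x₀ y) = 0
        rw [hy, inner_zero_right]
      obtain ⟨u, hu⟩ := hs y
      rw [← inner_self_eq_zero (𝕜 := ℝ)]
      nth_rewrite 2 [← hu]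
      rw [← hadj, h1, inner_zero_left]
    exact ContinuousLinearMap.isUnit_iff_bijective.2
      ⟨hinj, (LinearMap.injective_iff_surjective (f := (B x₀).toLinearMap)).1 hinj⟩
  · rintro x ⟨hxM, hxV⟩
    have hxU := hxV.1
    have hFx : F x = 0 := by
      have : x ∈ U ∩ F ⁻¹' {0} := hM ▸ ⟨hxM, hxU⟩
      exact this.2
    have hFat : ContDiffAt ℝ 2 F x := hF.contDiffAt (hU.mem_nhds hxU)
    have hFd : HasFDerivAt F (fderiv ℝ F x) x :=
      (hFat.differentiableAt (by norm_num)).hasFDerivAt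
    have hAd : HasFDerivAt A (fderiv ℝ A x) x :=
      ((hA.contDiffAt (hVo.mem_nhds hxV)).differentiableAt (by norm_num)).hasFDerivAt
    have hψd : fderiv ℝ (fun x => A x (F x)) x = (A x).comp (fderiv ℝ F x) := by
      rw [(hAd.clm_apply hFd).fderiv, hFx]
      simp
    have hBinv : ∀ y, fderiv ℝ F x (A x y) = y := fun y => by
      have := Ring.mul_inverse_cancel (B x) hxV.2
      exact DFunLike.congr_fun this y
    rw [hψd]
    refine ⟨by simp [hFx], ?_, fun v hv => ?_⟩
    · refine ContinuousLinearMap.opNorm_le_bound _ zero_le_one fun u => ?_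
      set p := (A x).comp (fderiv ℝ F x) u with hp
      have h1 : inner ℝ p p = inner ℝ p u := by
        have h2 : ∀ z, inner ℝ p z = inner ℝ (Ring.inverse (B x) (fderiv ℝ F x u))
          (fderiv ℝ F x z) := fun z => hadj _ _ _
        rw [h2, h2, hp]
        exact congrArg _ (hBinv _)
      rw [real_inner_self_eq_norm_sq] at h1
      have h3 := real_inner_le_norm p u
      by_contra! hlt
      rw [one_mul] at hlt
      nlinarith [norm_nonneg u, norm_nonneg p]
    · set w := v - A x (fderiv ℝ F x v) with hw
      have hker : fderiv ℝ F x w = 0 := by rw [hw, map_sub, hBinv, sub_self]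
      have htan : w ∈ tangentConeAt ℝ M x := by
        refine mem_tangentConeAt_of_fderiv_eq_zero (hU.mem_nhds hxU) (fun y hy hy' => ?_)
          (hFat.hasStrictFDerivAt (by norm_num)) (fun y => ⟨_, hBinv y⟩) hker
        have : y ∈ M ∩ U := hM ▸ ⟨hy, hy'.trans hFx⟩
        exact this.1
      have h1 : inner ℝ w v = 0 := hv w (Submodule.subset_span htan)
      have h2 : inner ℝ w (A x (fderiv ℝ F x v)) = 0 := by
        rw [real_inner_comm]
        refine (hadj _ _ _).trans ?_
        rw [hker, inner_zero_right]
      have h3 : inner ℝ w w = 0 := by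
        nth_rewrite 2 [hw]
        rw [inner_sub_right, h1, h2, sub_zero]
      exact (sub_eq_zero.1 (inner_self_eq_zero.1 h3)).symm

/-- Local maps vanishing on `M`, whose derivatives at points of `M` are contractions fixing the
vectors in `N`, can be glued to a map on a neighbourhood of `M`. -/
lemma exists_normal_map {E : Type*} [NormedAddCommGroup E] [InnerProductSpace ℝ E]
    [FiniteDimensional ℝ E] {M C : Set E} {N : E → Set E} (hC : IsClosed C) (hMC : Disjoint M C)
    (hloc : ∀ x₀ ∈ M, ∃ (V : Set E) (ψ : E → E), IsOpen V ∧ x₀ ∈ V ∧ ContDiffOn ℝ 1 ψ V ∧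
      ∀ x ∈ M ∩ V, ψ x = 0 ∧ ‖fderiv ℝ ψ x‖ ≤ 1 ∧ ∀ v ∈ N x, fderiv ℝ ψ x v = v) :
    ∃ (W : Set E) (ψ : E → E), IsOpen W ∧ M ⊆ W ∧ Disjoint W C ∧ DifferentiableOn ℝ ψ W ∧
      (∀ x ∈ W, ‖fderiv ℝ ψ x‖ ≤ 2) ∧
      ∀ x ∈ M, ψ x = 0 ∧ ∀ v ∈ N x, fderiv ℝ ψ x v = v := by
  choose! V ψ hVo hxV hψ hψM using hloc
  have hball : ∀ x : M, ∃ r : ℝ, 0 < r ∧ closedBall (x : E) r ⊆ V x := fun x =>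
    nhds_basis_closedBall.mem_iff.1 ((hVo x x.2).mem_nhds (hxV x x.2))
  choose r hr0 hrV using hball
  let χ : ∀ x : M, ContDiffBump (x : E) := fun x => ⟨r x / 2, r x, half_pos (hr0 x),
    half_lt_self (hr0 x)⟩
  obtain ⟨T, hTc, hT⟩ := TopologicalSpace.isOpen_iUnion_countable
    (fun x : M => ball (x : E) (r x)) fun _ => isOpen_ball
  have : Countable T := hTc
  let h : T → E → ℝ × E := fun i y => (χ i y, χ i y • ψ (i : M) y)
  have hzero : ∀ (i : T) y, y ∉ V (i : M) → h i =ᶠ[𝓝 y] 0 := by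
    intro i y hy
    have : y ∉ closedBall ((i : M) : E) (r i) := fun hy' => hy (hrV i hy')
    filter_upwards [isClosed_closedBall.isOpen_compl.mem_nhds this] with z hz
    have : χ (i : M) z = 0 := (χ (i : M)).zero_of_le_dist (by
      rw [Set.mem_compl_iff, mem_closedBall, not_le] at hz; exact hz.le)
    simp [h, this]
  have hψat : ∀ (i : T) y, y ∈ V (i : M) → ContDiffAt ℝ 1 (ψ (i : M)) y := fun i y hy =>
    (hψ _ (i : M).2).contDiffAt ((hVo _ (i : M).2).mem_nhds hy)
  have hχat : ∀ (i : T) y, ContDiffAt ℝ 1 (χ (i : M)) y := fun i y =>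
    (χ (i : M)).contDiff.contDiffAt
  have hh : ∀ i, ContDiff ℝ 1 (h i) := fun i => contDiff_iff_contDiffAt.2 fun y => by
    by_cases hy : y ∈ V (i : M)
    · exact (hχat i y).prodMk ((hχat i y).smul (hψat i y hy))
    · exact contDiffAt_const.congr_of_eventuallyEq (hzero i y hy)
  have hcs : ∀ i, HasCompactSupport (h i) := fun i =>
    (χ (i : M)).hasCompactSupport.mono' (subset_trans (fun y hy => by
      contrapose! hy
      have hy' : χ (i : M) y = 0 := by simpa using hy
      simp [h, hy']) subset_closure)
  obtain ⟨a, ha0, ha⟩ := exists_weights h hh hcs one_pos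
  obtain ⟨s1, s2, s3, s4, -⟩ := ha a (fun i => (ha0 i).le) fun i => le_rfl
  set S : E → ℝ × E := fun x => ∑' i, a i • h i x with hS
  set S' : E → E →L[ℝ] ℝ × E := fun x => ∑' i, a i • fderiv ℝ (h i) x with hS'
  have hSC : ContDiff ℝ 1 S := contDiff_one_iff_hasFDerivAt.2 ⟨S', s4, s3⟩
  have sum1 : ∀ x, HasSum (fun i => a i * χ (i : M) x) (S x).1 := fun x =>
    (s1 x).hasSum.mapL (ContinuousLinearMap.fst ℝ ℝ E)
  have sum2 : ∀ x, HasSum (fun i => a i • χ (i : M) x • ψ (i : M) x) (S x).2 := fun x =>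
    (s1 x).hasSum.mapL (ContinuousLinearMap.snd ℝ ℝ E)
  have sum3 : ∀ x u, HasSum (fun i => a i • (fderiv ℝ (h i) x u).2) (S' x u).2 := fun x u =>
    (s2 x).hasSum.mapL
      ((ContinuousLinearMap.snd ℝ ℝ E).comp (ContinuousLinearMap.apply ℝ (ℝ × E) u))
  have hpos : ∀ x ∈ M, 0 < (S x).1 := fun x hx => by
    have : x ∈ ⋃ i ∈ T, ball ((i : M) : E) (r i) := by
      rw [hT]
      exact Set.mem_iUnion.2 ⟨⟨x, hx⟩, mem_ball_self (hr0 _)⟩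
    obtain ⟨i, hiT, hi⟩ := Set.mem_iUnion₂.1 this
    rw [← (sum1 x).tsum_eq]
    exact (sum1 x).summable.tsum_pos (fun i => mul_nonneg (ha0 i).le (χ (i : M)).nonneg) ⟨i, hiT⟩
      (mul_pos (ha0 _) ((χ i).pos_of_mem_ball hi))
  have hχV : ∀ (i : T) x, x ∉ V (i : M) → χ (i : M) x = 0 := fun i x hx =>
    congrArg Prod.fst (hzero i x hx).self_of_nhds
  have hS2 : ∀ x ∈ M, (S x).2 = 0 := fun x hx => by
    rw [← (sum2 x).tsum_eq]
    refine (tsum_congr fun i => ?_).trans tsum_zero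
    by_cases hi : x ∈ V (i : M)
    · rw [(hψM _ (i : M).2 x ⟨hx, hi⟩).1, smul_zero, smul_zero]
    · rw [hχV i x hi, zero_smul, smul_zero]
  have hderiv : ∀ x ∈ M, ∀ (i : T) u,
      (fderiv ℝ (h i) x u).2 = χ (i : M) x • fderiv ℝ (ψ (i : M)) x u := by
    intro x hx i u
    by_cases hi : x ∈ V (i : M)
    · have h1 : HasFDerivAt (h i) _ x :=
        ((hχat i x).differentiableAt one_ne_zero).hasFDerivAt.prodMk
        (((hχat i x).differentiableAt one_ne_zero).hasFDerivAt.smul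
          ((hψat i x hi).differentiableAt one_ne_zero).hasFDerivAt)
      rw [h1.fderiv]
      simp [(hψM _ (i : M).2 x ⟨hx, hi⟩).1]
    · rw [(hzero i x hi).fderiv_eq, hχV i x hi]
      simp
  let W₀ : Set E := {x | 0 < (S x).1}
  have hW₀ : IsOpen W₀ := isOpen_lt continuous_const hSC.continuous.fst
  let Ψ : E → E := fun x => ((S x).1)⁻¹ • (S x).2
  have hΨ : ContDiffOn ℝ 1 Ψ W₀ := fun x hx => ContDiffAt.contDiffWithinAt
    ((hSC.contDiffAt.fst.inv (ne_of_gt hx)).smul hSC.contDiffAt.snd)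
  have hΨd : ∀ x ∈ M, ∀ u, fderiv ℝ Ψ x u = ((S x).1)⁻¹ • (S' x u).2 := by
    intro x hx u
    have h1 : DifferentiableAt ℝ (fun x => ((S x).1)⁻¹) x :=
      ((hSC.contDiffAt.fst.inv (hpos x hx).ne').differentiableAt one_ne_zero)
    have h2 : HasFDerivAt (fun x => (S x).2) ((ContinuousLinearMap.snd ℝ ℝ E).comp (S' x)) x :=
      (s3 x).snd
    have h3 : HasFDerivAt Ψ _ x := h1.hasFDerivAt.smul h2
    rw [h3.fderiv]
    simp [hS2 x hx]
  have hcont : ContinuousOn (fun x => ‖fderiv ℝ Ψ x‖) W₀ :=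
    (hΨ.continuousOn_fderiv_of_isOpen hW₀ le_rfl).norm
  refine ⟨(W₀ ∩ (fun x => ‖fderiv ℝ Ψ x‖) ⁻¹' Set.Iio 2) ∩ Cᶜ, Ψ,
    (hcont.isOpen_inter_preimage hW₀ isOpen_Iio).inter hC.isOpen_compl,
    fun x hx => ⟨⟨hpos x hx, (show ‖fderiv ℝ Ψ x‖ < 2 from lt_of_le_of_lt ?_ one_lt_two)⟩,
      fun hxC => hMC.le_bot ⟨hx, hxC⟩⟩,
    Set.disjoint_left.2 fun x hx => hx.2, ?_, fun x hx => le_of_lt hx.1.2, fun x hx =>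
      ⟨by simp [Ψ, hS2 x hx], fun v hv => ?_⟩⟩
  · refine ContinuousLinearMap.opNorm_le_bound _ zero_le_one fun u => ?_
    rw [hΨd x hx, norm_smul, norm_inv, Real.norm_of_nonneg (hpos x hx).le, one_mul,
      inv_mul_le_iff₀ (hpos x hx), ← (sum3 x u).tsum_eq]
    refine tsum_of_norm_bounded ((sum1 x).mul_right ‖u‖) fun i => ?_
    rw [hderiv x hx, norm_smul, norm_smul, Real.norm_of_nonneg (ha0 i).le,
      Real.norm_of_nonneg (χ (i : M)).nonneg, mul_assoc]
    refine mul_le_mul_of_nonneg_left ?_ (ha0 i).le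
    by_cases hi : x ∈ V (i : M)
    · refine mul_le_mul_of_nonneg_left ?_ (χ (i : M)).nonneg
      simpa using ContinuousLinearMap.le_of_opNorm_le _ (hψM _ (i : M).2 x ⟨hx, hi⟩).2.1 u
    · rw [hχV i x hi, zero_mul, zero_mul]
  · exact (hΨ.differentiableOn one_ne_zero).mono fun x hx => hx.1.1
  · rw [hΨd x hx, inv_smul_eq_iff₀ (hpos x hx).ne']
    refine (sum3 x v).unique ?_
    refine ((sum1 x).smul_const v).congr_fun ?_
    intro i
    rw [hderiv x hx, mul_smul]
    by_cases hi : x ∈ V (i : M)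
    · rw [(hψM _ (i : M).2 x ⟨hx, hi⟩).2.2 v hv]
    · rw [hχV i x hi, zero_smul, zero_smul]

/-- The square of the positive part of `1 - s` is differentiable. -/
lemma hasDerivAt_max_zero_one_sub_sq (s : ℝ) :
    HasDerivAt (fun s : ℝ => max 0 (1 - s) ^ 2) (-2 * max 0 (1 - s)) s := by
  rcases lt_trichotomy s 1 with hs | rfl | hs
  · have h : (fun s : ℝ => max 0 (1 - s) ^ 2) =ᶠ[𝓝 s] fun s => (1 - s) ^ 2 := by
      filter_upwards [gt_mem_nhds hs] with y hy
      rw [max_eq_right (by linarith)]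
    rw [max_eq_right (by linarith)]
    refine HasDerivAt.congr_of_eventuallyEq ?_ h
    have h1 := ((hasDerivAt_id' s).const_sub 1).fun_pow 2
    exact h1.congr_deriv (by push_cast; ring)
  · have h : (fun s : ℝ => max 0 (1 - s) ^ 2) =O[𝓝 1] fun s => (s - 1) ^ 2 := by
      refine Asymptotics.IsBigO.of_bound 1 (Eventually.of_forall fun y => ?_)
      rw [one_mul, Real.norm_of_nonneg (sq_nonneg _), Real.norm_of_nonneg (sq_nonneg _)]
      refine sq_le_sq.2 ?_
      rw [abs_of_nonneg (le_max_left _ _), abs_sub_comm]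
      exact max_le (abs_nonneg _) (le_abs_self _)
    rw [hasDerivAt_iff_isLittleO]
    have h2 : (fun s : ℝ => (s - 1) ^ 2) =o[𝓝 1] fun s => s - 1 := by
      simpa using! Asymptotics.isLittleO_pow_sub_sub (1 : ℝ) (one_lt_two)
    simpa using h.trans_isLittleO h2
  · have h : (fun s : ℝ => max 0 (1 - s) ^ 2) =ᶠ[𝓝 s] fun s => 0 := by
      filter_upwards [lt_mem_nhds hs] with y hy
      rw [max_eq_left (by linarith)]
      simp
    rw [max_eq_left (by linarith), mul_zero]
    exact (hasDerivAt_const s 0).congr_of_eventuallyEq h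

/-- A small cut-off of a map `ψ` has controlled derivative. -/
lemma exists_hasFDerivAt_cutoff {E : Type*} [NormedAddCommGroup E] [InnerProductSpace ℝ E]
    {ψ : E → E} {τ ρ : E → ℝ} {x : E} (hψ : DifferentiableAt ℝ ψ x)
    (hτ : DifferentiableAt ℝ τ x) (hρ : DifferentiableAt ℝ ρ x) (hψ2 : ‖fderiv ℝ ψ x‖ ≤ 2)
    (hτ4 : ‖fderiv ℝ τ x‖ ≤ 1 / 4) (hρ8 : ‖fderiv ℝ ρ x‖ ≤ 1 / 8) (hτ0 : 0 ≤ τ x)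
    (hρ0 : 0 < ρ x) :
    ∃ L : E →L[ℝ] E,
      HasFDerivAt (fun y => max 0 (1 - (‖ψ y‖ ^ 2 + τ y ^ 2) * (ρ y)⁻¹ ^ 2) ^ 2 • ψ y) L x ∧
      ‖L‖ ≤ 12 ∧ (ψ x = 0 → τ x = 0 → L = fderiv ℝ ψ x) := by
  have hk : HasFDerivAt (fun y => (ρ y)⁻¹) (-(ρ x ^ 2)⁻¹ • fderiv ℝ ρ x) x :=
    (hasDerivAt_inv hρ0.ne').comp_hasFDerivAt x hρ.hasFDerivAt
  have ht := (hψ.hasFDerivAt.norm_sq.add (hτ.hasFDerivAt.pow 2)).mul (hk.pow 2)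
  have hΨ := ((hasDerivAt_max_zero_one_sub_sq _).comp_hasFDerivAt x ht).smul hψ.hasFDerivAt
  refine ⟨_, hΨ, ?_, fun h0 h1 => ?_⟩
  · refine ContinuousLinearMap.opNorm_le_bound _ (by norm_num) fun u => ?_
    have b1 : ‖fderiv ℝ ψ x u‖ ≤ 2 * ‖u‖ := ContinuousLinearMap.le_of_opNorm_le _ hψ2 u
    have b2 : |fderiv ℝ τ x u| ≤ 1 / 4 * ‖u‖ := ContinuousLinearMap.le_of_opNorm_le _ hτ4 u
    have b3 : |fderiv ℝ ρ x u| ≤ 1 / 8 * ‖u‖ := ContinuousLinearMap.le_of_opNorm_le _ hρ8 u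
    have b4 : |inner ℝ (ψ x) (fderiv ℝ ψ x u)| ≤ ‖ψ x‖ * (2 * ‖u‖) :=
      (abs_real_inner_le_norm _ _).trans (mul_le_mul_of_nonneg_left b1 (norm_nonneg _))
    set m := max 0 (1 - (‖ψ x‖ ^ 2 + τ x ^ 2) * (ρ x)⁻¹ ^ 2) with hm
    set k := (ρ x)⁻¹ with hkdef
    have hk0 : 0 < k := inv_pos.2 hρ0
    set p := ‖ψ x‖ * k with hp
    set s := τ x * k with hs
    set R := fderiv ℝ ρ x u with hR
    set T := fderiv ℝ τ x u with hT
    set J := k * inner ℝ (ψ x) (fderiv ℝ ψ x u) with hJ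
    have hp0 : 0 ≤ p := mul_nonneg (norm_nonneg _) hk0.le
    have hs0 : 0 ≤ s := mul_nonneg hτ0 hk0.le
    have hU := norm_nonneg u
    have hm0 : 0 ≤ m := le_max_left _ _
    have hts : (‖ψ x‖ ^ 2 + τ x ^ 2) * k ^ 2 = p ^ 2 + s ^ 2 := by rw [hp, hs]; ring
    have hm1 : m ≤ 1 := by
      rw [hm, hts]; exact max_le zero_le_one (by nlinarith)
    have hJb : |J| ≤ 2 * p * ‖u‖ := by
      rw [hJ, abs_mul, abs_of_pos hk0]
      calc k * _ ≤ k * (‖ψ x‖ * (2 * ‖u‖)) := mul_le_mul_of_nonneg_left b4 hk0.le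
        _ = _ := by rw [hp]; ring
    have hmain : m * |2 * (p ^ 2 + s ^ 2) * p * R - 2 * p * J - 2 * p * s * T| ≤ 5 * ‖u‖ := by
      rcases lt_or_ge 1 (p ^ 2 + s ^ 2) with h1 | h1
      · have : m = 0 := by rw [hm, hts]; exact max_eq_left (by linarith)
        rw [this, zero_mul]; positivity
      · refine (mul_le_of_le_one_left (abs_nonneg _) hm1).trans ?_
        have hp1 : p ≤ 1 := by nlinarith
        have e1 : |2 * (p ^ 2 + s ^ 2) * p * R| ≤ 2 * 1 * 1 * (1 / 8 * ‖u‖) := by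
          rw [abs_mul, abs_of_nonneg (by positivity)]
          gcongr
        have e2 : |2 * p * J| ≤ 2 * 1 * (2 * 1 * ‖u‖) := by
          rw [abs_mul, abs_of_nonneg (by positivity)]
          refine mul_le_mul (by linarith) (hJb.trans ?_) (abs_nonneg _) (by norm_num)
          gcongr
        have e3 : |2 * p * s * T| ≤ 1 * (1 / 4 * ‖u‖) := by
          rw [abs_mul, abs_of_nonneg (by positivity)]
          refine mul_le_mul ?_ b2 (abs_nonneg _) zero_le_one
          nlinarith [sq_nonneg (p - s)]
        rw [abs_le] at *
        constructor <;> linarith [e1.1, e1.2, e2.1, e2.2, e3.1, e3.2]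
    calc _ = ‖(m ^ 2) • fderiv ℝ ψ x u + (2 * m * ((‖ψ x‖ ^ 2 + τ x ^ 2) * (2 * k * (k ^ 2 * R)) -
          k ^ 2 * (2 * inner ℝ (ψ x) (fderiv ℝ ψ x u)) - k ^ 2 * (2 * τ x * T))) • ψ x‖ := by
            congr 1
            simp [hkdef, hm, hR, hT]
            congr 1
            ring
      _ ≤ 1 * (2 * ‖u‖) + 2 * (5 * ‖u‖) := by
            refine (norm_add_le _ _).trans (add_le_add ?_ ?_)
            · rw [norm_smul, Real.norm_of_nonneg (sq_nonneg m)]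
              exact mul_le_mul (pow_le_one₀ hm0 hm1) b1 (norm_nonneg _) zero_le_one
            · rw [norm_smul, Real.norm_eq_abs, abs_mul, abs_of_nonneg (by positivity : 0 ≤ 2 * m)]
              refine le_trans (le_of_eq ?_) (mul_le_mul_of_nonneg_left hmain zero_le_two)
              rw [mul_assoc, mul_assoc, mul_assoc]
              congr 2
              rw [show ∀ a : ℝ, |a| * ‖ψ x‖ = |a * ‖ψ x‖| from fun a => by rw [abs_mul, abs_norm]]
              congr 1
              rw [hp, hs, hJ]
              ring
      _ = 12 * ‖u‖ := by ring
  · ext u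
    simp [h0, h1]

/-- A differentiable map close to the identity, equal to the identity to first order on `C` and
on `M`, where moreover its derivative vanishes in the directions `N`. -/
lemma exists_retract {E : Type*} [NormedAddCommGroup E] [InnerProductSpace ℝ E]
    [FiniteDimensional ℝ E] {M C W : Set E} {N : E → Set E} {ψ : E → E} (hC : IsClosed C)
    (hMC : IsClosed (M ∪ C)) (hW : IsOpen W) (hMW : M ⊆ W) (hWC : Disjoint W C)
    (hψ : DifferentiableOn ℝ ψ W) (hψ2 : ∀ x ∈ W, ‖fderiv ℝ ψ x‖ ≤ 2)
    (hψM : ∀ x ∈ M, ψ x = 0 ∧ ∀ v ∈ N x, fderiv ℝ ψ x v = v)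
    {e : E → ℝ} (he : Continuous e) (he0 : ∀ x, 0 < e x) :
    ∃ Φ : E → E, Differentiable ℝ Φ ∧ (∀ x, dist (Φ x) x < e x) ∧ LipschitzWith 13 Φ ∧
      (∀ x ∈ C, Φ x = x ∧ fderiv ℝ Φ x = ContinuousLinearMap.id ℝ E) ∧
      ∀ x ∈ M, Φ x = x ∧ ∀ v ∈ N x, fderiv ℝ Φ x v = 0 := by
  obtain ⟨τ, hτ, hτ0, hτO, hτz, hτ4⟩ := exists_small_contDiff hMC.isOpen_compl
    (e := fun _ => 1) continuousOn_const (fun _ _ => one_pos) (c := 1 / 4) (by norm_num)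
  obtain ⟨ω, hω, hω0, hωO, hωz, -⟩ := exists_small_contDiff hW
    (e := fun _ => 1) continuousOn_const (fun _ _ => one_pos) one_pos
  obtain ⟨ρ, hρ, hρ0, hρO, hρz, hρ8⟩ := exists_small_contDiff hC.isOpen_compl
    (e := fun x => min (e x / 2) ((ω x + τ x) / 2))
    (Continuous.continuousOn ((he.div_const 2).min ((hω.continuous.add hτ.continuous).div_const 2)))
    (fun x hx => by
      refine lt_min (half_pos (he0 x)) (half_pos ?_)
      by_cases hM : x ∈ M
      · exact add_pos_of_pos_of_nonneg (hωO x (hMW hM)).1 (hτ0 x)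
      · exact add_pos_of_nonneg_of_pos (hω0 x) (hτO x fun h => h.elim hM hx).1)
    (c := 1 / 8) (by norm_num)
  classical
  let Ψ₀ : E → E := fun y => max 0 (1 - (‖ψ y‖ ^ 2 + τ y ^ 2) * (ρ y)⁻¹ ^ 2) ^ 2 • ψ y
  let Ψ : E → E := fun y => if y ∈ W then Ψ₀ y else 0
  have hΨW : ∀ y ∈ W, Ψ y = Ψ₀ y := fun y hy => if_pos hy
  have hΨn : ∀ y ∉ W, Ψ y = 0 := fun y hy => if_neg hy
  have hWρ : ∀ y ∈ W, 0 < ρ y := fun y hy => (hρO y fun h => hWC.le_bot ⟨hy, h⟩).1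
  have hzero : ∀ y, 0 < ρ y → ρ y ^ 2 ≤ ‖ψ y‖ ^ 2 + τ y ^ 2 → Ψ₀ y = 0 := by
    intro y h0 h1
    have : 1 ≤ (‖ψ y‖ ^ 2 + τ y ^ 2) * (ρ y)⁻¹ ^ 2 := by
      rw [inv_pow, ← div_eq_mul_inv, one_le_div (by positivity)]
      exact h1
    simp only [Ψ₀]
    rw [max_eq_left (by linarith)]
    simp
  have hbound : ∀ y, ‖Ψ y‖ ≤ ρ y := by
    intro y
    by_cases hy : y ∈ W
    · rw [hΨW y hy]
      by_cases h1 : ρ y ^ 2 ≤ ‖ψ y‖ ^ 2 + τ y ^ 2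
      · rw [hzero y (hWρ y hy) h1, norm_zero]; exact hρ0 y
      · have h2 : ‖ψ y‖ ≤ ρ y := by
          refine abs_le_of_sq_le_sq' ?_ (hρ0 y) |>.2
          nlinarith [sq_nonneg (τ y)]
        have h3 : max 0 (1 - (‖ψ y‖ ^ 2 + τ y ^ 2) * (ρ y)⁻¹ ^ 2) ≤ 1 :=
          max_le zero_le_one (by
            linarith [show 0 ≤ (‖ψ y‖ ^ 2 + τ y ^ 2) * (ρ y)⁻¹ ^ 2 by positivity])
        simp only [Ψ₀]
        rw [norm_smul, Real.norm_of_nonneg (by positivity)]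
        exact (mul_le_of_le_one_left (norm_nonneg _)
          (pow_le_one₀ (le_max_left _ _) h3)).trans h2
    · rw [hΨn y hy, norm_zero]; exact hρ0 y
  have hderC : ∀ x ∈ C, HasFDerivAt Ψ (0 : E →L[ℝ] E) x := by
    intro x hx
    have hρx : ρ x = 0 := hρz x fun h => h hx
    have hxW : x ∉ W := fun h => hWC.le_bot ⟨h, hx⟩
    have hmin : IsLocalMin ρ x := Eventually.of_forall fun y => by rw [hρx]; exact hρ0 y
    have h1 : HasFDerivAt ρ (0 : E →L[ℝ] ℝ) x := by
      rw [← hmin.fderiv_eq_zero]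
      exact (hρ.differentiable one_ne_zero x).hasFDerivAt
    rw [hasFDerivAt_iff_isLittleO] at h1 ⊢
    refine Asymptotics.IsBigO.trans_isLittleO ?_ h1
    refine Asymptotics.IsBigO.of_bound 1 (Eventually.of_forall fun y => ?_)
    simp only [hΨn x hxW, hρx, sub_zero, zero_apply, one_mul]
    rw [Real.norm_of_nonneg (hρ0 y)]
    exact hbound y
  have hderW : ∀ x ∈ W, ∃ L : E →L[ℝ] E, HasFDerivAt Ψ L x ∧ ‖L‖ ≤ 12 ∧
      (ψ x = 0 → τ x = 0 → L = fderiv ℝ ψ x) := by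
    intro x hx
    obtain ⟨L, hL, hL1⟩ := exists_hasFDerivAt_cutoff (hψ.differentiableAt (hW.mem_nhds hx))
      (hτ.differentiable one_ne_zero x) (hρ.differentiable one_ne_zero x) (hψ2 x hx) (hτ4 x)
      (hρ8 x) (hτ0 x) (hWρ x hx)
    refine ⟨L, hL.congr_of_eventuallyEq ?_, hL1⟩
    filter_upwards [hW.mem_nhds hx] with y hy using hΨW y hy
  have hder : ∀ x, ∃ L : E →L[ℝ] E, HasFDerivAt Ψ L x ∧ ‖L‖ ≤ 12 := by
    intro x
    by_cases hxC : x ∈ C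
    · exact ⟨0, hderC x hxC, by simp⟩
    by_cases hxW : x ∈ W
    · obtain ⟨L, h1, h2, -⟩ := hderW x hxW
      exact ⟨L, h1, h2⟩
    refine ⟨0, (hasFDerivAt_const (0 : E) x).congr_of_eventuallyEq ?_, by simp⟩
    have h1 : ρ x < τ x := by
      have := (hρO x hxC).2.trans (min_le_right _ _)
      rw [hωz x hxW] at this
      linarith [(hρO x hxC).1]
    filter_upwards [hρ.continuous.continuousAt.eventually_lt hτ.continuous.continuousAt h1,
      hρ.continuous.continuousAt.eventually (lt_mem_nhds (hρO x hxC).1)] with y hy hy0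
    by_cases hyW : y ∈ W
    · rw [hΨW y hyW]
      exact hzero y hy0 (by nlinarith [sq_nonneg ‖ψ y‖])
    · exact hΨn y hyW
  choose L hL hL12 using hder
  have hΦ : ∀ x, HasFDerivAt (fun y => y - Ψ y) (ContinuousLinearMap.id ℝ E - L x) x :=
    fun x => (hasFDerivAt_id x).sub (hL x)
  refine ⟨fun y => y - Ψ y, fun x => (hΦ x).differentiableAt, fun x => ?_, ?_, fun x hx => ⟨?_, ?_⟩,
    fun x hx => ⟨?_, fun v hv => ?_⟩⟩
  · rw [dist_eq_norm, sub_sub_cancel_left, norm_neg]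
    refine (hbound x).trans_lt ?_
    by_cases hx : x ∈ C
    · rw [hρz x fun h => h hx]; exact he0 x
    · linarith [(hρO x hx).2.trans (min_le_left _ _), he0 x]
  · refine lipschitzWith_of_nnnorm_fderiv_le (𝕜 := ℝ) (fun x => (hΦ x).differentiableAt) fun x => ?_
    rw [(hΦ x).fderiv, ← NNReal.coe_le_coe, coe_nnnorm]
    refine (norm_sub_le _ _).trans ?_
    have := ContinuousLinearMap.norm_id_le (𝕜 := ℝ) (E := E)
    have h13 : ((13 : NNReal) : ℝ) = 13 := rfl
    rw [h13]
    linarith [hL12 x]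
  · simp [hΨn x fun h => hWC.le_bot ⟨h, hx⟩]
  · rw [(hΦ x).fderiv, (hL x).unique (hderC x hx), sub_zero]
  · simp [hΨW x (hMW hx), Ψ₀, (hψM x hx).1]
  · obtain ⟨L', h1, -, h2⟩ := hderW x (hMW hx)
    rw [(hΦ x).fderiv, (hL x).unique h1, h2 (hψM x hx).1 (hτz x fun h => h (Or.inl hx))]
    simp [(hψM x hx).2 v hv]

/-- A continuous positive function has a positive Lipschitz `C¹` minorant. -/
lemma exists_small_lipschitz {E : Type*} [NormedAddCommGroup E] [InnerProductSpace ℝ E]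
    [FiniteDimensional ℝ E] {e : E → ℝ} (he : Continuous e) (he0 : ∀ x, 0 < e x) {c : NNReal}
    (hc : 0 < c) :
    ∃ ρ : E → ℝ, ContDiff ℝ 1 ρ ∧ (∀ x, 0 < ρ x) ∧ (∀ x, ρ x ≤ e x) ∧ LipschitzWith c ρ := by
  obtain ⟨ρ, h1, -, h2, -, h3⟩ := exists_small_contDiff isOpen_univ he.continuousOn
    (fun x _ => he0 x) (NNReal.coe_pos.2 hc)
  exact ⟨ρ, h1, fun x => (h2 x trivial).1, fun x => (h2 x trivial).2,
    lipschitzWith_of_nnnorm_fderiv_le (𝕜 := ℝ) (h1.differentiable one_ne_zero) h3⟩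

namespace CpStratification

variable {n : ℕ} {Q : Set (EuclideanSpace ℝ (Fin n))}

/-- A union of strata containing every stratum of dimension smaller than that of a member is
closed. -/
lemma isClosed_biUnion {p : ℕ∞} (A : CpStratification n p Q) (hQ : IsClosed Q)
    {S : Finset (Set (EuclideanSpace ℝ (Fin n)))} (hS : S ⊆ A.strata)
    (hdim : ∀ L ∈ S, ∀ K ∈ A.strata, A.dim K < A.dim L → K ∈ S) : IsClosed (⋃ L ∈ S, L) := by
  refine isClosed_of_closure_subset ?_
  rw [Finset.closure_biUnion]
  intro x hx
  simp only [Set.mem_iUnion] at hx ⊢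
  obtain ⟨L, hL, hxL⟩ := hx
  have hLQ : L ⊆ Q := A.covers ▸ Set.subset_sUnion_of_mem (Finset.mem_coe.2 (hS hL))
  have hxQ : x ∈ Q := closure_minimal hLQ hQ hxL
  rw [← A.covers] at hxQ
  obtain ⟨K, hK, hxK⟩ := hxQ
  rw [Finset.mem_coe] at hK
  by_cases hKL : K = L
  · exact ⟨L, hL, hKL ▸ hxK⟩
  · exact ⟨K, hdim L hL K hK (A.dim_lt K hK L (hS hL) hKL
      (A.frontierCond K hK L (hS hL) hKL ⟨x, hxK, hxL⟩)), hxK⟩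

/-- For every stratum there is a map close to the identity whose derivative kills the normal
directions of the stratum, and which does not affect the strata of smaller dimension. -/
lemma exists_stratum_retract (A : CpStratification n 2 Q) (hQ : IsClosed Q)
    {M : Set (EuclideanSpace ℝ (Fin n))} (hM : M ∈ A.strata) {e : EuclideanSpace ℝ (Fin n) → ℝ}
    (he : Continuous e) (he0 : ∀ x, 0 < e x) :
    ∃ Φ : EuclideanSpace ℝ (Fin n) → EuclideanSpace ℝ (Fin n),
      Differentiable ℝ Φ ∧ (∀ x, dist (Φ x) x < e x) ∧ LipschitzWith 13 Φ ∧
      (∀ L ∈ A.strata, L ≠ M → A.dim L ≤ A.dim M → ∀ x ∈ L,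
        Φ x = x ∧ fderiv ℝ Φ x = ContinuousLinearMap.id ℝ _) ∧
      ∀ x ∈ M, Φ x = x ∧ ∀ v ∈ normalSp n M x, fderiv ℝ Φ x v = 0 := by
  classical
  let S := A.strata.filter fun L => L ≠ M ∧ A.dim L ≤ A.dim M
  have hS : ∀ L, L ∈ S ↔ L ∈ A.strata ∧ L ≠ M ∧ A.dim L ≤ A.dim M := fun L => Finset.mem_filter
  have hC : IsClosed (⋃ L ∈ S, L) := by
    refine A.isClosed_biUnion hQ (Finset.filter_subset _ _) fun L hL K hK hKL => ?_
    have := (hS L).1 hL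
    exact (hS K).2 ⟨hK, fun h => by rw [h] at hKL; omega, by omega⟩
  have hMC : IsClosed (M ∪ ⋃ L ∈ S, L) := by
    rw [show M ∪ ⋃ L ∈ S, L = ⋃ L ∈ insert M S, L by simp]
    refine A.isClosed_biUnion hQ
      (Finset.insert_subset hM (Finset.filter_subset _ _)) fun L hL K hK hKL => ?_
    rw [Finset.mem_insert, hS] at hL ⊢
    refine or_iff_not_imp_left.2 fun h => ⟨hK, h, ?_⟩
    rcases hL with rfl | hL <;> omega
  have hdisj : Disjoint M (⋃ L ∈ S, L) := by
    simp only [Set.disjoint_iUnion_right]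
    exact fun L hL => A.pairwiseDisjoint M hM L ((hS L).1 hL).1 (Ne.symm ((hS L).1 hL).2.1)
  obtain ⟨W, ψ, hW, hMW, hWC, hψ, hψ2, hψM⟩ := exists_normal_map
    (N := fun x => (normalSp n M x : Set (EuclideanSpace ℝ (Fin n)))) hC hdisj fun x₀ hx₀ => by
      obtain ⟨U, F, hU, hxU, hF, hMU, hs⟩ := A.isManifold M hM x₀ hx₀
      exact exists_local_normal_map hU hxU hF hMU hs
  obtain ⟨Φ, h1, h2, h3, h4, h5⟩ := exists_retract hC hMC hW hMW hWC hψ hψ2 hψM he he0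
  exact ⟨Φ, h1, h2, h3, fun L hL hLM hd x hx =>
    h4 x (Set.mem_biUnion ((hS L).2 ⟨hL, hLM, hd⟩) hx), h5⟩

/-- A map close to the identity whose derivative kills all normal directions of the strata. -/
lemma exists_retract (A : CpStratification n 2 Q) (hQ : IsClosed Q)
    {e : EuclideanSpace ℝ (Fin n) → ℝ} (he : Continuous e) (he0 : ∀ x, 0 < e x) :
    ∃ Φ : EuclideanSpace ℝ (Fin n) → EuclideanSpace ℝ (Fin n),
      Differentiable ℝ Φ ∧ (∀ x, dist (Φ x) x < e x) ∧ LipschitzWith (13 ^ A.strata.card) Φ ∧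
      ∀ M ∈ A.strata, ∀ x ∈ M, ∀ v ∈ normalSp n M x, fderiv ℝ Φ x v = 0 := by
  classical
  suffices H : ∀ s : Finset (Set (EuclideanSpace ℝ (Fin n))), s ⊆ A.strata →
      ∀ e : EuclideanSpace ℝ (Fin n) → ℝ, Continuous e → (∀ x, 0 < e x) →
      ∃ Φ : EuclideanSpace ℝ (Fin n) → EuclideanSpace ℝ (Fin n),
        Differentiable ℝ Φ ∧ (∀ x, dist (Φ x) x < e x) ∧ LipschitzWith (13 ^ s.card) Φ ∧
        ∀ M ∈ s, ∀ x ∈ M, ∀ v ∈ normalSp n M x, fderiv ℝ Φ x v = 0 from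
    H _ subset_rfl e he he0
  intro s
  induction s using Finset.induction_on_max_value A.dim with
  | empty =>
    intro _ e _ he0
    exact ⟨id, differentiable_id, fun x => by simpa using he0 x, by simpa using LipschitzWith.id,
      by simp⟩
  | insert M s hMs hmax ih =>
    intro hs e he he0
    obtain ⟨hM, hs⟩ := Finset.insert_subset_iff.1 hs
    obtain ⟨e', he'1, he'0, he'e, he'L⟩ := exists_small_lipschitz he he0 one_pos
    have hc : Continuous fun x => e' x / 4 := he'1.continuous.div_const 4
    have hc0 : ∀ x, 0 < e' x / 4 := fun x => by linarith [he'0 x]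
    obtain ⟨Φ, hΦ, hΦe, hΦL, hΦs⟩ := ih hs _ hc hc0
    obtain ⟨Θ, hΘ, hΘe, hΘL, hΘs, hΘM⟩ := A.exists_stratum_retract hQ hM hc hc0
    have hcomp : ∀ x, fderiv ℝ (Φ ∘ Θ) x = (fderiv ℝ Φ (Θ x)).comp (fderiv ℝ Θ x) :=
      fun x => fderiv_comp x (hΦ _) (hΘ x)
    refine ⟨Φ ∘ Θ, hΦ.comp hΘ, fun x => ?_, ?_, ?_⟩
    · have h1 := hΦe (Θ x)
      have h2 := hΘe x
      have h3 : e' (Θ x) ≤ e' x + dist (Θ x) x := by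
        have := (le_abs_self _).trans (he'L.dist_le_mul (Θ x) x)
        rw [NNReal.coe_one, one_mul] at this
        linarith
      calc dist (Φ (Θ x)) x ≤ dist (Φ (Θ x)) (Θ x) + dist (Θ x) x := dist_triangle _ _ _
        _ < e x := by linarith [he'e x, he'0 x]
    · rw [Finset.card_insert_of_notMem hMs, pow_succ]
      exact hΦL.comp hΘL
    · intro L hL x hx v hv
      rw [hcomp, ContinuousLinearMap.comp_apply]
      rcases Finset.mem_insert.1 hL with rfl | hL
      · rw [(hΘM x hx).2 v hv, map_zero]
      · obtain ⟨h1, h2⟩ := hΘs L (hs hL) (fun h => hMs (h ▸ hL)) (hmax L hL) x hx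
        rw [h1, h2]
        exact hΦs L hL x hx v hv

end CpStratification

/-- Truncating a function at a small level and subtracting changes it little and at most doubles
its Lipschitz constants. -/
lemma exists_vanishing_near_zeros {E : Type*} [NormedAddCommGroup E] [InnerProductSpace ℝ E]
    [FiniteDimensional ℝ E] {f ε : E → ℝ} (hf : Continuous f) (hε : Continuous ε)
    (hε0 : ∀ x, 0 < ε x) {a b : E} (hab : f a ≠ f b) :
    ∃ h e : E → ℝ, Continuous h ∧ Continuous e ∧ (∀ x, 0 < e x) ∧ (∀ x, |h x - f x| ≤ ε x) ∧
      (∀ x, |f x| ≤ e x → h x = 0) ∧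
      ∀ κ : NNReal, LipschitzWith κ f → LipschitzWith (κ + κ) h := by
  have hab' : a ≠ b := fun h => hab (congrArg f h)
  have hc : 0 < nndist (f a) (f b) / nndist a b :=
    div_pos (pos_iff_ne_zero.2 (nndist_eq_zero.not.2 hab))
      (pos_iff_ne_zero.2 (nndist_eq_zero.not.2 hab'))
  obtain ⟨e, he, he0, heε, heL⟩ := exists_small_lipschitz hε hε0 hc
  refine ⟨fun x => f x - max (-e x) (min (f x) (e x)), e,
    hf.sub (he.continuous.neg.max (hf.min he.continuous)), he.continuous, he0, fun x => ?_,
    fun x hx => ?_, fun κ hκ => ?_⟩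
  · rw [sub_sub_cancel_left, abs_neg, abs_le]
    exact ⟨(neg_le_neg (heε x)).trans (le_max_left _ _),
      max_le (by linarith [he0 x, heε x]) ((min_le_right _ _).trans (heε x))⟩
  · rw [abs_le] at hx
    simp only
    rw [min_eq_left hx.2, max_eq_right hx.1, sub_self]
  · have hcκ : nndist (f a) (f b) / nndist a b ≤ κ :=
      div_le_of_le_mul₀ zero_le zero_le (hκ.nndist_le a b)
    have heκ := heL.weaken hcκ
    refine hκ.sub ?_
    simpa using heκ.neg.max (hκ.min heκ)

/-- **Approximation on stratified sets.** -/
theorem approximation_on_stratified_sets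
    (n m : ℕ) (Q : Set (EuclideanSpace ℝ (Fin n))) (hQ : IsClosed Q)
    (f ε : EuclideanSpace ℝ (Fin n) → ℝ)
    (hf : Continuous f) (hε : Continuous ε) (hε0 : ∀ x, 0 < ε x)
    (A : CpStratification n 2 Q) (hm : A.strata.card = m)
    (V₁ : Set (EuclideanSpace ℝ (Fin n))) (hV₁ : IsOpen V₁)
    (hsupp : Function.support f ⊆ V₁) :
    ∃ g : EuclideanSpace ℝ (Fin n) → ℝ,
      Differentiable ℝ g ∧
      (∀ x, |f x - g x| < ε x) ∧
      (∀ M ∈ A.strata, ∀ x ∈ M, gradient g x ∈ tangentSp n M x) ∧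
      (∀ κ : NNReal, LipschitzWith κ f → LipschitzWith (13 ^ (m + 1) * κ) g) ∧
      Function.support g ⊆ V₁ := by
  by_cases hconst : ∀ a b, f a = f b
  · have hfc : f = fun _ => f 0 := funext fun x => hconst x 0
    refine ⟨f, hfc ▸ differentiable_const _, fun x => by simpa using hε0 x,
      fun M _ x _ => ?_, fun κ _ => hfc ▸ LipschitzWith.const' _, hsupp⟩
    rw [hfc]
    simp [gradient]
  push Not at hconst
  obtain ⟨a, b, hab⟩ := hconst
  obtain ⟨h, e, hh, he, he0, hhf, hhz, hhL⟩ := exists_vanishing_near_zeros hf (hε.div_const 2)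
    (fun x => half_pos (hε0 x)) hab
  obtain ⟨δ, hδ, hδ0, hδF⟩ := exists_modulus
    (hh.prodMk (hf.div he fun x => (he0 x).ne'))
    ((hε.div_const 4).min continuous_const) fun x => lt_min (by linarith [hε0 x]) one_pos
  obtain ⟨r, hr, hr0, hrδ, hrL⟩ := exists_small_lipschitz (e := fun x => min (δ x / 4) 1)
    ((hδ.div_const 4).min continuous_const)
    (fun x => lt_min (by linarith [hδ0 x]) one_pos) one_pos
  obtain ⟨f₀, hf₀, hf₀a, hf₀L⟩ := exists_mollification hh hr hr0
    (fun x => (hrδ x).trans (min_le_right _ _)) hrL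
  obtain ⟨Φ, hΦ, hΦr, hΦL, hΦA⟩ := A.exists_retract hQ hr.continuous hr0
  have hnear : ∀ x y, dist y (Φ x) ≤ r (Φ x) →
      dist (h y, f y / e y) (h x, f x / e x) < min (ε x / 4) 1 := by
    intro x y hy
    refine hδF x y ?_
    have h1 : r (Φ x) ≤ r x + dist (Φ x) x := by
      have := (le_abs_self _).trans (hrL.dist_le_mul (Φ x) x)
      rw [NNReal.coe_one, one_mul] at this
      linarith
    linarith [hΦr x, hr0 x, dist_triangle y (Φ x) x, (hrδ x).trans (min_le_left _ _)]
  refine ⟨f₀ ∘ Φ, hf₀.comp hΦ, fun x => ?_, fun M hM x hx => ?_, fun κ hκ => ?_,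
    fun x hx => hsupp fun hfx => hx ?_⟩
  · have h1 : |f₀ (Φ x) - h x| ≤ ε x / 4 := hf₀a _ _ _ fun y hy =>
      ((le_max_left _ _).trans_lt (hnear x y hy)).le.trans (min_le_left _ _)
    have h2 := hhf x
    rw [abs_le] at h1 h2
    rw [Function.comp_apply, abs_lt]
    constructor <;> linarith [hε0 x]
  · rw [← Submodule.orthogonal_orthogonal (tangentSp n M x), Submodule.mem_orthogonal']
    intro v hv
    rw [gradient, InnerProductSpace.toDual_symm_apply, fderiv_comp x (hf₀ _) (hΦ x),
      ContinuousLinearMap.comp_apply, hΦA M hM x hx v hv, map_zero]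
  · refine ((hf₀L _ (hhL κ hκ)).comp hΦL).weaken ?_
    rw [hm, pow_succ]
    calc 2 * (κ + κ) * 13 ^ m = 13 ^ m * 4 * κ := by ring
      _ ≤ 13 ^ m * 13 * κ := by gcongr; norm_num
  · have hxe : h x = 0 := hhz x (by rw [hfx, abs_zero]; exact (he0 x).le)
    have h1 : |f₀ (Φ x) - 0| ≤ 0 := hf₀a _ _ _ fun y hy => by
      have h2 := ((le_max_right _ _).trans_lt (hnear x y hy)).trans_le (min_le_right _ _)
      simp only [hfx, zero_div, dist_zero_right, Real.norm_eq_abs] at h2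
      rw [abs_div, abs_of_pos (he0 y), div_lt_one (he0 y)] at h2
      simp [hhz y h2.le]
    simpa using h1

end
end

section
/- Let Q ⊆ ℝⁿ be a closed set, f : ℝⁿ → ℝ a continuous function, ε : ℝⁿ → (0,∞) a continuous function, and let 𝒜 be a C²-stratification of Q consisting of m strata that in addition satisfies Whitney condition (a). Then there exists a C¹-smooth function g : ℝⁿ → ℝ satisfying simultaneously: |f(x) − g(x)| < ε(x) for all x ∈ ℝⁿ; for every stratum M ∈ 𝒜 and every x ∈ M the gradient ∇g(x) lies in the tangent space T_xM; if f is κ-Lipschitz then g can be chosen 13^{m+1}·κ-Lipschitz; and given any open neighborhood V₁ of the support of f, g can be chosen with support contained in V₁. -/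
open Filter Topology Metric

noncomputable section

/-- Whitney condition (a) for a stratification. -/
def WhitneyConditionA {n : ℕ} {p : ℕ∞} {Q : Set (EuclideanSpace ℝ (Fin n))}
    (A : CpStratification n p Q) : Prop :=
  ∀ M ∈ A.strata, ∀ L ∈ A.strata,
    ∀ (x v : ℕ → EuclideanSpace ℝ (Fin n)) (x' v' : EuclideanSpace ℝ (Fin n)),
      (∀ k, x k ∈ M) → x' ∈ L → Tendsto x atTop (nhds x') →
      (∀ k, v k ∈ normalSp n M (x k)) → Tendsto v atTop (nhds v') →
      v' ∈ normalSp n L x'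

section SmoothSeries

variable {E V : Type*} [NormedAddCommGroup E] [NormedSpace ℝ E] [NormedAddCommGroup V]
  [NormedSpace ℝ V]

theorem contDiff_one_tsum [CompleteSpace V] {h : ℕ → E → V} {u : ℕ → ℝ} (hu : Summable u)
    (hc : ∀ k, ContDiff ℝ 1 (h k)) (h0 : ∀ k y, ‖h k y‖ ≤ u k)
    (h1 : ∀ k y, ‖fderiv ℝ (h k) y‖ ≤ u k) :
    ContDiff ℝ 1 (fun y => ∑' k, h k y) ∧
      ∀ y, HasFDerivAt (fun y => ∑' k, h k y) (∑' k, fderiv ℝ (h k) y) y := by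
  have hd : ∀ y, HasFDerivAt (fun y => ∑' k, h k y) (∑' k, fderiv ℝ (h k) y) y := fun y =>
    hasFDerivAt_tsum (x₀ := y) hu
      (fun k x => ((hc k).differentiable one_ne_zero x).hasFDerivAt) h1
      (Summable.of_norm_bounded hu fun k => h0 k y) y
  refine ⟨contDiff_one_iff_fderiv.2 ⟨fun y => (hd y).differentiableAt, ?_⟩, hd⟩
  rw [show fderiv ℝ (fun y => ∑' k, h k y) = fun y => ∑' k, fderiv ℝ (h k) y from
    funext fun y => (hd y).fderiv]
  exact continuous_tsum (fun k => (hc k).continuous_fderiv one_ne_zero) hu h1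

theorem HasCompactSupport.exists_bound_fderiv {h : E → V} (hs : HasCompactSupport h)
    (hc : ContDiff ℝ 1 h) : ∃ B > 0, ∀ y, ‖h y‖ ≤ B ∧ ‖fderiv ℝ h y‖ ≤ B := by
  obtain ⟨B, hB⟩ := hs.exists_bound_of_continuous hc.continuous
  obtain ⟨C, hC⟩ := (hs.fderiv (𝕜 := ℝ)).exists_bound_of_continuous
    (hc.continuous_fderiv one_ne_zero)
  exact ⟨max 1 (max B C), by positivity, fun y =>
    ⟨(hB y).trans (by simp), (hC y).trans (by simp)⟩⟩

theorem exists_bump_cover [FiniteDimensional ℝ E] {S : Set E} (hS : S.Nonempty) {U : E → Set E}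
    (hU : ∀ x ∈ S, U x ∈ 𝓝 x) :
    ∃ (c : ℕ → E) (w : ℕ → E → ℝ), (∀ k, c k ∈ S) ∧ (∀ k, ContDiff ℝ 1 (w k)) ∧
      (∀ k, HasCompactSupport (w k)) ∧ (∀ k, tsupport (w k) ⊆ U (c k)) ∧
      (∀ k y, 0 ≤ w k y) ∧ ∀ x ∈ S, ∃ k, 0 < w k x := by
  have key : ∀ x, ∃ f : E → ℝ, x ∈ S → tsupport f ⊆ U x ∧ HasCompactSupport f ∧
      ContDiff ℝ 1 f ∧ Set.range f ⊆ Set.Icc 0 1 ∧ f x = 1 := by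
    intro x
    by_cases hx : x ∈ S
    · obtain ⟨f, hf⟩ := exists_contDiff_tsupport_subset (n := 1) (hU x hx)
      exact ⟨f, fun _ => hf⟩
    · exact ⟨0, fun h => absurd h hx⟩
  choose f hf using key
  obtain ⟨t, hts, htc, ht⟩ := TopologicalSpace.countable_cover_nhdsWithin
    (f := fun x => {y | 0 < f x y}) (s := S) (fun x hx => mem_nhdsWithin_of_mem_nhds
      ((isOpen_lt continuous_const (hf x hx).2.2.1.continuous).mem_nhds
        (by simp [(hf x hx).2.2.2.2])))
  have htn : t.Nonempty := by
    obtain ⟨x, hx⟩ := hS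
    obtain ⟨y, hy, -⟩ := Set.mem_iUnion₂.1 (ht hx)
    exact ⟨y, hy⟩
  obtain ⟨c, rfl⟩ := htc.exists_eq_range htn
  have hcS : ∀ k, c k ∈ S := fun k => hts ⟨k, rfl⟩
  refine ⟨c, fun k => f (c k), hcS, fun k => (hf _ (hcS k)).2.2.1, fun k => (hf _ (hcS k)).2.1,
    fun k => (hf _ (hcS k)).1, fun k y => ((hf _ (hcS k)).2.2.2.1 ⟨y, rfl⟩).1, fun x hx => ?_⟩
  obtain ⟨y, ⟨k, rfl⟩, hy⟩ := Set.mem_iUnion₂.1 (ht hx)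
  exact ⟨k, hy⟩

theorem exists_contDiff_regulator [FiniteDimensional ℝ E] {Ω : Set E} (hΩ : IsOpen Ω)
    {P : E → ℝ → Prop}
    (hP : ∀ x ∈ Ω, ∃ c > 0, ∀ᶠ y in 𝓝 x, ∀ t, 0 < t → t ≤ c → P y t) {b : ℝ} (hb : 0 < b) :
    ∃ r : E → ℝ, ContDiff ℝ 1 r ∧ (∀ y ∈ Ω, 0 < r y ∧ P y (r y)) ∧ (∀ y ∉ Ω, r y = 0) ∧
      ∀ y, ‖fderiv ℝ r y‖ ≤ b := by
  rcases Ω.eq_empty_or_nonempty with rfl | hne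
  · exact ⟨0, contDiff_const, by simp, by simp, fun y => by simp [Pi.zero_def, hb.le]⟩
  have key : ∀ x, ∃ c > 0, x ∈ Ω → ∀ᶠ y in 𝓝 x, ∀ t, 0 < t → t ≤ c → P y t := by
    intro x
    by_cases hx : x ∈ Ω
    · obtain ⟨c, hc, h⟩ := hP x hx
      exact ⟨c, hc, fun _ => h⟩
    · exact ⟨1, one_pos, fun h => absurd h hx⟩
  choose δ hδ hδP using key
  obtain ⟨c, w, hcS, hwc, hws, hwU, hw0, hwp⟩ := exists_bump_cover hne
    (U := fun x => Ω ∩ {y | ∀ t, 0 < t → t ≤ δ x → P y t})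
    (fun x hx => inter_mem (hΩ.mem_nhds hx) (hδP x hx))
  choose B hB hwB using fun k => (hws k).exists_bound_fderiv (hwc k)
  set u : ℕ → ℝ := fun k => (1 / 2) ^ (k + 1) with hu
  have hup : ∀ k, 0 < u k := fun k => by positivity
  have husum : HasSum u 1 := by
    have := hasSum_geometric_two.mul_left (1 / 2 : ℝ)
    simpa [hu, pow_succ, mul_comm] using this
  set a : ℕ → ℝ := fun k => u k * (min b (δ (c k)) / B k) with ha
  have hm : ∀ k, 0 < min b (δ (c k)) := fun k => lt_min hb (hδ _)
  have hap : ∀ k, 0 < a k := fun k => mul_pos (hup k) (div_pos (hm k) (hB k))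
  have haB : ∀ k, a k * B k = u k * min b (δ (c k)) := fun k => by
    simp only [ha]; field_simp [(hB k).ne']
  have hub : Summable fun k => u k * b := husum.summable.mul_right b
  have hC : ∀ k, ContDiff ℝ 1 (fun y => a k * w k y) := fun k => contDiff_const.mul (hwc k)
  have hn0 : ∀ k y, a k * w k y ≤ u k * min b (δ (c k)) := fun k y => by
    rw [← haB]
    exact mul_le_mul_of_nonneg_left ((le_abs_self _).trans (hwB k y).1) (hap k).le
  have hnn : ∀ k y, 0 ≤ a k * w k y := fun k y => mul_nonneg (hap k).le (hw0 k y)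
  have hn : ∀ k y, ‖a k * w k y‖ ≤ u k * b := fun k y => by
    rw [Real.norm_of_nonneg (hnn k y)]
    exact (hn0 k y).trans (mul_le_mul_of_nonneg_left (min_le_left _ _) (hup k).le)
  have hfd : ∀ k y, ‖fderiv ℝ (fun y => a k * w k y) y‖ ≤ u k * b := fun k y => by
    rw [fderiv_const_mul ((hwc k).differentiable one_ne_zero y), norm_smul,
      Real.norm_of_nonneg (hap k).le]
    calc a k * ‖fderiv ℝ (w k) y‖ ≤ a k * B k :=
          mul_le_mul_of_nonneg_left (hwB k y).2 (hap k).le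
      _ ≤ u k * b := by
          rw [haB]; exact mul_le_mul_of_nonneg_left (min_le_left _ _) (hup k).le
  obtain ⟨hr, hrd⟩ := contDiff_one_tsum hub hC hn hfd
  have hsm : ∀ y, Summable fun k => a k * w k y := fun y =>
    Summable.of_norm_bounded hub fun k => hn k y
  refine ⟨_, hr, fun y hy => ?_, fun y hy => ?_, fun y => ?_⟩
  · obtain ⟨k, hk⟩ := hwp y hy
    have hpos : 0 < ∑' k, a k * w k y :=
      (hsm y).tsum_pos (fun k => hnn k y) k (mul_pos (hap k) hk)
    refine ⟨hpos, ?_⟩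
    set r := ∑' k, a k * w k y with hrdef
    by_contra hcon
    have hlt : ∀ k, w k y ≠ 0 → δ (c k) < r := by
      intro k hk
      by_contra hle
      exact hcon ((hwU k (subset_tsupport _ hk)).2 r hpos (not_lt.1 hle))
    have hle : ∀ k, a k * w k y ≤ u k * r := by
      intro k
      by_cases hk : w k y = 0
      · simpa [hk] using mul_nonneg (hup k).le hpos.le
      · exact (hn0 k y).trans (mul_le_mul_of_nonneg_left
          ((min_le_right _ _).trans (hlt k hk).le) (hup k).le)
    have hlt' : a k * w k y < u k * r :=
      (hn0 k y).trans_lt (mul_lt_mul_of_pos_left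
          ((min_le_right _ _).trans_lt (hlt k hk.ne')) (hup k))
    have := Summable.tsum_lt_tsum hle hlt' (hsm y) (husum.summable.mul_right r)
    rw [tsum_mul_right, husum.tsum_eq, one_mul] at this
    exact lt_irrefl _ this
  · have : ∀ k, a k * w k y = 0 := fun k => by
      have : w k y = 0 := by
        by_contra hk
        exact hy (hwU k (subset_tsupport _ hk)).1
      simp [this]
    simp [this]
  · rw [(hrd y).fderiv]
    have := tsum_of_norm_bounded (husum.mul_right b) fun k => hfd k y
    simpa using this

end SmoothSeries

section LevelSet

theorem mem_tangentConeAt_of_curve {E : Type*} [NormedAddCommGroup E]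
    [NormedSpace ℝ E] {M : Set E} {γ : ℝ → E} {w : E} (hγ : HasDerivAt γ w 0)
    (hM : ∀ᶠ t in 𝓝 0, γ t ∈ M) : w ∈ tangentConeAt ℝ M (γ 0) := by
  have h := hasDerivAt_iff_tendsto_slope_zero.1 hγ
  refine mem_tangentConeAt_of_seq (𝓝[≠] (0 : ℝ)) (fun t => t⁻¹) (fun t => γ t - γ 0) ?_ ?_ ?_
  · have := hγ.continuousAt.tendsto.sub_const (γ 0)
    rw [sub_self] at this
    exact this.mono_left nhdsWithin_le_nhds
  · filter_upwards [nhdsWithin_le_nhds hM] with t ht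
    simpa using ht
  · simpa using h

variable {E F : Type*} [NormedAddCommGroup E] [InnerProductSpace ℝ E] [FiniteDimensional ℝ E]
  [NormedAddCommGroup F] [InnerProductSpace ℝ F] [FiniteDimensional ℝ F]

theorem exists_curve_of_mem_ker {f : E → F} {f' : E →L[ℝ] F} {x : E}
    (hf : HasStrictFDerivAt f f' x) (hs : Function.Surjective f') {w : E} (hw : f' w = 0) :
    ∃ γ : ℝ → E, γ 0 = x ∧ HasDerivAt γ w 0 ∧ ∀ᶠ t in 𝓝 0, f (γ t) = f x := by
  have hr : f'.range = ⊤ := LinearMap.range_eq_top.2 hs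
  let k : f'.ker := ⟨w, hw⟩
  have hline : HasDerivAt (fun t : ℝ => t • k) k 0 := by
    simpa using (hasDerivAt_id (0 : ℝ)).smul_const k
  refine ⟨fun t => hf.implicitFunction f f' hr (f x) (t • k), by simp, ?_, ?_⟩
  · have h := (hf.to_implicitFunction hr).hasFDerivAt
    rw [← zero_smul ℝ k] at h
    simpa [k, Function.comp_def] using h.comp_hasDerivAt (0 : ℝ) hline
  · have h := hf.map_implicitFunction_eq hr
    have ht : Tendsto (fun t : ℝ => (f x, t • k)) (𝓝 0) (𝓝 (f x, 0)) := by
      have := hline.continuousAt.tendsto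
      rw [zero_smul] at this
      exact tendsto_const_nhds.prodMk_nhds this
    exact ht.eventually h

/-- The adjoint of real operators, as a linear map between the operator spaces. -/
def realAdjoint : (E →L[ℝ] F) →L[ℝ] (F →L[ℝ] E) :=
  LinearMap.mkContinuous
    { toFun := fun A => A.adjoint
      map_add' := fun A B => map_add _ A B
      map_smul' := fun c A => by simp }
    1 (fun A => by simp)

theorem realAdjoint_apply (A : E →L[ℝ] F) : realAdjoint A = A.adjoint := rfl

theorem isUnit_comp_adjoint {A : E →L[ℝ] F} (hA : Function.Surjective A) :
    IsUnit (A ∘L realAdjoint A) := by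
  have hinj : Function.Injective (A ∘L realAdjoint A) := by
    rw [injective_iff_map_eq_zero]
    intro z hz
    obtain ⟨w, rfl⟩ := hA z
    have h1 : inner ℝ (A.adjoint (A w)) (A.adjoint (A w)) = 0 := by
      rw [ContinuousLinearMap.adjoint_inner_left]
      have : A (A.adjoint (A w)) = 0 := hz
      rw [this, inner_zero_right]
    have h2 : A.adjoint (A w) = 0 := inner_self_eq_zero.1 h1
    have h3 : inner ℝ (A w) (A w) = 0 := by
      rw [← ContinuousLinearMap.adjoint_inner_left, h2, inner_zero_left]
    exact inner_self_eq_zero.1 h3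
  rw [ContinuousLinearMap.isUnit_iff_bijective]
  exact ⟨hinj, (LinearMap.injective_iff_surjective
    (f := ((A ∘L realAdjoint A : F →L[ℝ] F) : F →ₗ[ℝ] F))).1 hinj⟩

theorem surjective_of_isUnit_comp_adjoint {A : E →L[ℝ] F} (hA : IsUnit (A ∘L realAdjoint A)) :
    Function.Surjective A := by
  rw [ContinuousLinearMap.isUnit_iff_bijective] at hA
  exact Function.Surjective.of_comp (g := realAdjoint A) hA.2

/-- The operator `A† (A A†)⁻¹`. -/
def pinv (A : E →L[ℝ] F) : F →L[ℝ] E := realAdjoint A ∘L Ring.inverse (A ∘L realAdjoint A)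

theorem pinv_comp_self {A : E →L[ℝ] F} (hA : Function.Surjective A) {K : Submodule ℝ E}
    (hK : K = (A.ker)ᗮ) : pinv A ∘L A = K.starProjection := by
  subst hK
  ext1 w
  have hU := isUnit_comp_adjoint hA
  symm
  apply Submodule.eq_starProjection_of_mem_orthogonal
  · rw [Submodule.mem_orthogonal']
    intro k hk
    have hk : A k = 0 := hk
    simp only [pinv, ContinuousLinearMap.comp_apply, realAdjoint_apply]
    rw [ContinuousLinearMap.adjoint_inner_left, hk, inner_zero_right]
  · rw [Submodule.orthogonal_orthogonal]
    change A (w - (pinv A ∘L A) w) = 0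
    have h := Ring.mul_inverse_cancel _ hU
    have h' := DFunLike.congr_fun h (A w)
    rw [one_apply_eq_self] at h'
    rw [map_sub, sub_eq_zero]
    simp only [pinv, ContinuousLinearMap.comp_apply]
    exact h'.symm

theorem contDiffAt_pinv {A : E →L[ℝ] F} (hA : Function.Surjective A) :
    ContDiffAt ℝ 1 (pinv : (E →L[ℝ] F) → F →L[ℝ] E) A := by
  obtain ⟨u, hu⟩ := isUnit_comp_adjoint hA
  have h1 : ContDiffAt ℝ 1 (fun A : E →L[ℝ] F => A ∘L realAdjoint A) A :=
    contDiffAt_id.clm_comp (realAdjoint (E := E) (F := F)).contDiff.contDiffAt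
  have h2 : ContDiffAt ℝ 1 (Ring.inverse : (F →L[ℝ] F) → F →L[ℝ] F) (A ∘L realAdjoint A) := by
    rw [← hu]
    exact contDiffAt_ringInverse ℝ u
  exact (realAdjoint (E := E) (F := F)).contDiff.contDiffAt.clm_comp
    (h2.fun_comp A h1)

end LevelSet

section Manifold

variable {n d : ℕ} {M : Set (EuclideanSpace ℝ (Fin n))}

local notation "𝔼" => EuclideanSpace ℝ (Fin n)

theorem tangentSp_eq_ker {U : Set 𝔼} {F : 𝔼 → EuclideanSpace ℝ (Fin (n - d))} (hU : IsOpen U)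
    (hM : M ∩ U = U ∩ F ⁻¹' {0}) {x : 𝔼} (hxM : x ∈ M) (hxU : x ∈ U)
    (hF : HasStrictFDerivAt F (fderiv ℝ F x) x) (hs : Function.Surjective (fderiv ℝ F x)) :
    tangentSp n M x = (fderiv ℝ F x).ker := by
  have hiff : ∀ y ∈ U, y ∈ M ↔ F y = 0 := fun y hy => by
    have := Set.ext_iff.1 hM y
    simpa [hy] using this
  apply le_antisymm
  · refine Submodule.span_le.2 fun w hw => ?_
    have h0 : HasFDerivWithinAt F (0 : 𝔼 →L[ℝ] EuclideanSpace ℝ (Fin (n - d))) M x := by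
      refine (hasFDerivWithinAt_const (0 : EuclideanSpace ℝ (Fin (n - d))) x M).congr_of_eventuallyEq
        ?_ ((hiff x hxU).1 hxM)
      filter_upwards [self_mem_nhdsWithin, nhdsWithin_le_nhds (hU.mem_nhds hxU)] with y hy hyU
      exact (hiff y hyU).1 hy
    exact (hF.hasFDerivAt.hasFDerivWithinAt.unique_on h0) hw
  · intro w hw
    obtain ⟨γ, rfl, hγ, hγF⟩ := exists_curve_of_mem_ker hF hs hw
    refine Submodule.subset_span (mem_tangentConeAt_of_curve hγ ?_)
    filter_upwards [hγF, hγ.continuousAt.preimage_mem_nhds (hU.mem_nhds hxU)] with t ht htU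
    exact (hiff _ htU).2 (ht.trans ((hiff _ hxU).1 hxM))

theorem IsCpManifold.exists_curve (h : IsCpManifold n 2 d M) {x : 𝔼} (hx : x ∈ M) {w : 𝔼}
    (hw : w ∈ tangentSp n M x) :
    ∃ γ : ℝ → 𝔼, γ 0 = x ∧ HasDerivAt γ w 0 ∧ ∀ᶠ t in 𝓝 0, γ t ∈ M := by
  obtain ⟨U, F, hU, hxU, hF, hM, hs⟩ := h x hx
  have hst : HasStrictFDerivAt F (fderiv ℝ F x) x :=
    (hF.contDiffAt (hU.mem_nhds hxU)).hasStrictFDerivAt (by norm_num)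
  rw [tangentSp_eq_ker hU hM hx hxU hst hs] at hw
  have hiff : ∀ y ∈ U, y ∈ M ↔ F y = 0 := fun y hy => by
    have := Set.ext_iff.1 hM y
    simpa [hy] using this
  obtain ⟨γ, rfl, hγ, hγF⟩ := exists_curve_of_mem_ker hst hs hw
  refine ⟨γ, rfl, hγ, ?_⟩
  filter_upwards [hγF, hγ.continuousAt.preimage_mem_nhds (hU.mem_nhds hxU)] with t ht htU
  exact (hiff _ htU).2 (ht.trans ((hiff _ hxU).1 hx))

theorem IsCpManifold.exists_local_normal_field (h : IsCpManifold n 2 d M) {x₀ : 𝔼}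
    (hx₀ : x₀ ∈ M) :
    ∃ (U : Set 𝔼) (v : 𝔼 → 𝔼), IsOpen U ∧ x₀ ∈ U ∧ ContDiffOn ℝ 1 v U ∧
      ∀ x ∈ M ∩ U, v x = 0 ∧ fderiv ℝ v x = (normalSp n M x).starProjection := by
  obtain ⟨U, F, hU, hxU, hF, hM, hs⟩ := h x₀ hx₀
  have hDF : ContDiffOn ℝ 1 (fderiv ℝ F) U := hF.fderiv_of_isOpen hU (by norm_num)
  set U' := U ∩ fderiv ℝ F ⁻¹' {A | IsUnit (A ∘L realAdjoint A)} with hU'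
  have hV : IsOpen {A : 𝔼 →L[ℝ] EuclideanSpace ℝ (Fin (n - d)) | IsUnit (A ∘L realAdjoint A)} :=
    Units.isOpen.preimage (f := fun A : 𝔼 →L[ℝ] EuclideanSpace ℝ (Fin (n - d)) =>
      A ∘L realAdjoint A) (continuous_id.clm_comp realAdjoint.continuous)
  have hU'o : IsOpen U' := hDF.continuousOn.isOpen_inter_preimage hU hV
  have hsurj : ∀ x ∈ U', Function.Surjective (fderiv ℝ F x) := fun x hx =>
    surjective_of_isUnit_comp_adjoint hx.2
  have hFat : ∀ x ∈ U', ContDiffAt ℝ 2 F x := fun x hx => hF.contDiffAt (hU.mem_nhds hx.1)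
  have hR : ∀ x ∈ U', ContDiffAt ℝ 1 (fun y => pinv (fderiv ℝ F y)) x := fun x hx =>
    (contDiffAt_pinv (hsurj x hx)).comp x (hDF.contDiffAt (hU.mem_nhds hx.1))
  refine ⟨U', fun y => pinv (fderiv ℝ F y) (F y), hU'o, ⟨hxU, isUnit_comp_adjoint hs⟩,
    fun x hx => ?_, fun x hx => ?_⟩
  · exact ((hR x hx).clm_apply ((hFat x hx).of_le (by norm_num))).contDiffWithinAt
  · obtain ⟨hxM, hxU'⟩ := hx
    have hFx : F x = 0 := by
      have : x ∈ U ∩ F ⁻¹' {0} := hM ▸ ⟨hxM, hxU'.1⟩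
      exact this.2
    refine ⟨by simp [hFx], ?_⟩
    have h1 := ((hR x hxU').differentiableAt one_ne_zero).hasFDerivAt.clm_apply
      ((hFat x hxU').differentiableAt two_ne_zero).hasFDerivAt
    rw [h1.fderiv, hFx, map_zero, add_zero]
    refine pinv_comp_self (hsurj x hxU') ?_
    rw [normalSp, tangentSp_eq_ker hU hM hxM hxU'.1
      ((hFat x hxU').hasStrictFDerivAt (by norm_num)) (hsurj x hxU')]

end Manifold

theorem hasDerivAt_max_zero_sq (t : ℝ) :
    HasDerivAt (fun t : ℝ => (max 0 t) ^ 2) (2 * max 0 t) t := by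
  rcases lt_trichotomy t 0 with h | rfl | h
  · have : (fun t : ℝ => (max 0 t) ^ 2) =ᶠ[𝓝 t] fun _ => 0 := by
      filter_upwards [gt_mem_nhds h] with s hs
      simp [max_eq_left hs.le]
    simpa [max_eq_left h.le] using (hasDerivAt_const t (0 : ℝ)).congr_of_eventuallyEq this
  · simp only [max_self, mul_zero]
    rw [hasDerivAt_iff_isLittleO]
    simp only [max_self, sub_zero, smul_zero]
    have : (fun t : ℝ => (max 0 t) ^ 2 - 0 ^ 2) =O[𝓝 0] fun t : ℝ => t ^ 2 := by
      refine Asymptotics.IsBigO.of_bound 1 (Eventually.of_forall fun s => ?_)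
      rcases le_total 0 s with hs | hs <;> simp [hs, sq_nonneg]
    exact this.trans_isLittleO (Asymptotics.isLittleO_pow_id one_lt_two)
  · have : (fun t : ℝ => (max 0 t) ^ 2) =ᶠ[𝓝 t] fun t => t ^ 2 := by
      filter_upwards [lt_mem_nhds h] with s hs
      simp [max_eq_right hs.le]
    simpa [max_eq_right h.le] using (hasDerivAt_pow 2 t).congr_of_eventuallyEq this

theorem contDiff_max_zero_sq : ContDiff ℝ 1 (fun t : ℝ => (max 0 t) ^ 2) := by
  refine contDiff_one_iff_deriv.2 ⟨fun t => (hasDerivAt_max_zero_sq t).differentiableAt, ?_⟩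
  rw [show deriv (fun t : ℝ => (max 0 t) ^ 2) = fun t => 2 * max 0 t from
    funext fun t => (hasDerivAt_max_zero_sq t).deriv]
  fun_prop

section Cutoff

variable {E V : Type*} [NormedAddCommGroup V]

/-- A cutoff function equal to `1` where `v = 0` and vanishing where `‖v‖ ≥ r`. -/
def tubeCutoff (v : E → V) (r : E → ℝ) (y : E) : ℝ := (max 0 (1 - ‖v y‖ ^ 2 / r y ^ 2)) ^ 2

theorem tubeCutoff_nonneg (v : E → V) (r : E → ℝ) (y : E) : 0 ≤ tubeCutoff v r y := sq_nonneg _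

theorem tubeCutoff_le_one (v : E → V) (r : E → ℝ) (y : E) : tubeCutoff v r y ≤ 1 :=
  pow_le_one₀ (le_max_left _ _) (max_le zero_le_one (by
    have : 0 ≤ ‖v y‖ ^ 2 / r y ^ 2 := by positivity
    linarith))

theorem tubeCutoff_eq_zero {v : E → V} {r : E → ℝ} {y : E} (hr : 0 < r y) (h : r y ≤ ‖v y‖) :
    tubeCutoff v r y = 0 := by
  have : 1 ≤ ‖v y‖ ^ 2 / r y ^ 2 := by
    rw [one_le_div (by positivity)]
    gcongr
  rw [tubeCutoff, max_eq_left (by linarith)]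
  norm_num

theorem tubeCutoff_eq_one {v : E → V} {r : E → ℝ} {y : E} (h : v y = 0) :
    tubeCutoff v r y = 1 := by
  simp [tubeCutoff, h]

variable [NormedAddCommGroup E] [NormedSpace ℝ E] [InnerProductSpace ℝ V]

theorem contDiffAt_tubeCutoff {v : E → V} {r : E → ℝ} {y : E} (hv : ContDiffAt ℝ 1 v y)
    (hr : ContDiffAt ℝ 1 r y) (hr0 : 0 < r y) : ContDiffAt ℝ 1 (tubeCutoff v r) y :=
  contDiff_max_zero_sq.contDiffAt.fun_comp y
    (contDiffAt_const.sub ((hv.norm_sq ℝ).div (hr.pow 2) (by positivity)))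

theorem abs_fderiv_tubeCutoff_mul_norm_le {v : E → V} {r : E → ℝ} {y : E} {v' : E →L[ℝ] V}
    {r' : E →L[ℝ] ℝ} (hv : HasFDerivAt v v' y) (hr : HasFDerivAt r r' y) (hr0 : 0 < r y)
    (hv' : ‖v'‖ ≤ 3 / 2) (hr' : ‖r'‖ ≤ 1) (w : E) :
    |fderiv ℝ (tubeCutoff v r) y w| * ‖v y‖ ≤ 3 * ‖w‖ := by
  have h1 : HasFDerivAt (fun y => ‖v y‖ ^ 2 / r y ^ 2) _ y :=
    hv.norm_sq.mul ((hasDerivAt_inv (pow_pos hr0 2).ne').comp_hasFDerivAt y (hr.pow 2))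
  have h2 := (hasDerivAt_max_zero_sq (1 - ‖v y‖ ^ 2 / r y ^ 2)).comp_hasFDerivAt y
    (h1.const_sub 1)
  have h3 : HasFDerivAt (tubeCutoff v r) _ y := h2
  set σ := ‖v y‖ / r y with hσ
  have hσ0 : 0 ≤ σ := by positivity
  have hvy : ‖v y‖ = σ * r y := by rw [hσ]; field_simp
  have hs : ‖v y‖ ^ 2 / r y ^ 2 = σ ^ 2 := by rw [hσ, div_pow]
  set a := inner ℝ (v y) (v' w) with ha
  have ha' : |a| ≤ σ * r y * (3 / 2 * ‖w‖) := by
    refine (abs_real_inner_le_norm _ _).trans ?_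
    rw [hvy]
    exact mul_le_mul_of_nonneg_left (v'.le_of_opNorm_le hv' w) (by positivity)
  have hrw : |r' w| ≤ ‖w‖ := by simpa using r'.le_of_opNorm_le hr' w
  have hform : fderiv ℝ (tubeCutoff v r) y w =
      - (2 * max 0 (1 - σ ^ 2)) * (2 * a / r y ^ 2 - 2 * σ ^ 2 / r y * r' w) := by
    rw [h3.fderiv, hs]
    simp
    rw [hvy, ← ha]
    field_simp
    ring
  rw [hform, abs_mul, abs_neg, abs_of_nonneg (by positivity : 0 ≤ 2 * max 0 (1 - σ ^ 2))]
  have hb : |2 * a / r y ^ 2 - 2 * σ ^ 2 / r y * r' w| * ‖v y‖ ≤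
      (3 * σ ^ 2 + 2 * σ ^ 3) * ‖w‖ := by
    have e1 : |2 * a / r y ^ 2| ≤ 3 * σ / r y * ‖w‖ := by
      rw [abs_div, abs_mul, abs_of_pos (pow_pos hr0 2), abs_two, div_le_iff₀ (by positivity)]
      calc 2 * |a| ≤ 2 * (σ * r y * (3 / 2 * ‖w‖)) := by linarith
        _ = _ := by field_simp
    have e2 : |2 * σ ^ 2 / r y * r' w| ≤ 2 * σ ^ 2 / r y * ‖w‖ := by
      rw [abs_mul, abs_of_nonneg (by positivity : 0 ≤ 2 * σ ^ 2 / r y)]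
      exact mul_le_mul_of_nonneg_left hrw (by positivity)
    calc _ ≤ (3 * σ / r y * ‖w‖ + 2 * σ ^ 2 / r y * ‖w‖) * ‖v y‖ :=
          mul_le_mul_of_nonneg_right ((abs_sub _ _).trans (add_le_add e1 e2)) (norm_nonneg _)
      _ = _ := by rw [hvy]; field_simp
  rw [mul_assoc]
  rcases le_total 1 σ with h | h
  · have : max 0 (1 - σ ^ 2) = 0 := max_eq_left (by nlinarith)
    rw [this]
    simp
  · have : max 0 (1 - σ ^ 2) = 1 - σ ^ 2 := max_eq_right (by nlinarith)
    rw [this]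
    have h0 : 0 ≤ 1 - σ ^ 2 := by nlinarith
    calc _ ≤ 2 * (1 - σ ^ 2) * ((3 * σ ^ 2 + 2 * σ ^ 3) * ‖w‖) :=
          mul_le_mul_of_nonneg_left hb (by linarith)
      _ = (2 * (1 - σ ^ 2) * (3 * σ ^ 2 + 2 * σ ^ 3)) * ‖w‖ := by ring
      _ ≤ 3 * ‖w‖ := by
          refine mul_le_mul_of_nonneg_right ?_ (norm_nonneg _)
          have h4 : 2 * (1 - σ ^ 2) * (3 * σ ^ 2 + 2 * σ ^ 3) ≤
              2 * (1 - σ ^ 2) * (5 * σ ^ 2) :=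
            mul_le_mul_of_nonneg_left (by nlinarith [sq_nonneg σ]) (by linarith)
          nlinarith [sq_nonneg (2 * σ ^ 2 - 1)]

end Cutoff

theorem exists_glued_field {E V : Type*} [NormedAddCommGroup E] [NormedSpace ℝ E]
    [NormedAddCommGroup V] [NormedSpace ℝ V] [CompleteSpace V] {w : ℕ → E → ℝ} {v : ℕ → E → V}
    {U : ℕ → Set E} (hwc : ∀ k, ContDiff ℝ 1 (w k)) (hws : ∀ k, HasCompactSupport (w k))
    (hwU : ∀ k, tsupport (w k) ⊆ U k) (hw0 : ∀ k y, 0 ≤ w k y)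
    (hv : ∀ k, ∀ y ∈ U k, ContDiffAt ℝ 1 (v k) y) :
    ∃ (D : E → ℝ) (N : E → V), ContDiff ℝ 1 D ∧ ContDiff ℝ 1 N ∧
      (∀ y k, 0 < w k y → 0 < D y) ∧
      ∀ (x : E) (L : E →L[ℝ] V), (∀ k, x ∈ U k → v k x = 0 ∧ fderiv ℝ (v k) x = L) →
        N x = 0 ∧ HasFDerivAt N (D x • L) x := by
  have hoff : ∀ k, ∀ y ∉ tsupport (w k), (fun y => w k y • v k y) =ᶠ[𝓝 y] fun _ => 0 :=
    fun k y hy => by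
      filter_upwards [notMem_tsupport_iff_eventuallyEq.1 hy] with z hz
      simp [hz]
  have hhc : ∀ k, ContDiff ℝ 1 (fun y => w k y • v k y) := fun k =>
    contDiff_iff_contDiffAt.2 fun y => by
      by_cases hy : y ∈ tsupport (w k)
      · exact (hwc k).contDiffAt.smul (hv k y (hwU k hy))
      · exact contDiffAt_const.congr_of_eventuallyEq (hoff k y hy)
  have hhs : ∀ k, HasCompactSupport (fun y => w k y • v k y) := fun k => (hws k).smul_right
  choose A hA hwA using fun k => (hws k).exists_bound_fderiv (hwc k)
  choose B hB hhB using fun k => (hhs k).exists_bound_fderiv (hhc k)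
  obtain ⟨u, hu0, hus⟩ : ∃ u : ℕ → ℝ, (∀ k, 0 < u k) ∧ Summable u :=
    ⟨fun k => (1 / 2 : ℝ) ^ k, fun k => by positivity, summable_geometric_two⟩
  obtain ⟨a, hap, haA, haB⟩ : ∃ a : ℕ → ℝ, (∀ k, 0 < a k) ∧ (∀ k, a k * A k ≤ u k) ∧
      ∀ k, a k * B k ≤ u k := by
    have hap : ∀ k, 0 < u k / (A k + B k) := fun k =>
      div_pos (hu0 k) (add_pos (hA k) (hB k))
    have hmul : ∀ k, u k / (A k + B k) * (A k + B k) = u k := fun k =>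
      div_mul_cancel₀ _ (add_pos (hA k) (hB k)).ne'
    refine ⟨fun k => u k / (A k + B k), hap, fun k => ?_, fun k => ?_⟩
    · linarith [hmul k, mul_pos (hap k) (hB k)]
    · linarith [hmul k, mul_pos (hap k) (hA k)]
  have hDb : ∀ k y, ‖a k • w k y‖ ≤ u k := fun k y => by
    rw [norm_smul, Real.norm_of_nonneg (hap k).le]
    exact (mul_le_mul_of_nonneg_left (hwA k y).1 (hap k).le).trans (haA k)
  have hNb : ∀ k y, ‖a k • w k y • v k y‖ ≤ u k := fun k y => by
    rw [norm_smul, Real.norm_of_nonneg (hap k).le]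
    exact (mul_le_mul_of_nonneg_left (hhB k y).1 (hap k).le).trans (haB k)
  have hNf : ∀ k y, fderiv ℝ (fun y => a k • w k y • v k y) y =
      a k • fderiv ℝ (fun y => w k y • v k y) y := fun k y =>
    fderiv_fun_const_smul ((hhc k).differentiable one_ne_zero y) _
  have hDb' : ∀ k y, ‖fderiv ℝ (fun y => a k • w k y) y‖ ≤ u k := fun k y => by
    rw [fderiv_fun_const_smul ((hwc k).differentiable one_ne_zero y), norm_smul,
      Real.norm_of_nonneg (hap k).le]
    exact (mul_le_mul_of_nonneg_left (hwA k y).2 (hap k).le).trans (haA k)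
  have hNb' : ∀ k y, ‖fderiv ℝ (fun y => a k • w k y • v k y) y‖ ≤ u k := fun k y => by
    rw [hNf, norm_smul, Real.norm_of_nonneg (hap k).le]
    exact (mul_le_mul_of_nonneg_left (hhB k y).2 (hap k).le).trans (haB k)
  obtain ⟨hD, -⟩ := contDiff_one_tsum (h := fun k y => a k • w k y) hus
    (fun k => (hwc k).const_smul (a k)) hDb hDb'
  obtain ⟨hN, hNd⟩ := contDiff_one_tsum (h := fun k y => a k • w k y • v k y) hus
    (fun k => (hhc k).const_smul (a k)) hNb hNb'
  have hDsum : ∀ y, Summable fun k => a k • w k y := fun y =>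
    Summable.of_norm_bounded hus fun k => hDb k y
  refine ⟨_, _, hD, hN, fun y k hk => (hDsum y).tsum_pos
    (fun k => mul_nonneg (hap k).le (hw0 k y)) k (mul_pos (hap k) hk), fun x L hx => ?_⟩
  have hh0 : ∀ k, w k x • v k x = 0 := fun k => by
    by_cases hk : x ∈ tsupport (w k)
    · simp [(hx k (hwU k hk)).1]
    · simp [image_eq_zero_of_notMem_tsupport hk]
  have hh1 : ∀ k, fderiv ℝ (fun y => w k y • v k y) x = w k x • L := fun k => by
    by_cases hk : x ∈ tsupport (w k)
    · obtain ⟨e0, e1⟩ := hx k (hwU k hk)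
      rw [fderiv_fun_smul ((hwc k).differentiable one_ne_zero x)
        ((hv k x (hwU k hk)).differentiableAt one_ne_zero), e0, e1]
      ext1 z
      simp
    · rw [(hoff k x hk).fderiv_eq, image_eq_zero_of_notMem_tsupport hk]
      simp
  refine ⟨by simp [hh0], ?_⟩
  have hS : ∑' k, fderiv ℝ (fun y => a k • w k y • v k y) x = (∑' k, a k • w k x) • L := by
    rw [← (hDsum x).tsum_smul_const]
    exact tsum_congr fun k => by rw [hNf, hh1, smul_assoc]
  exact hS ▸ hNd x

section NormalField

variable {n d : ℕ} {M : Set (EuclideanSpace ℝ (Fin n))}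

local notation "𝔼" => EuclideanSpace ℝ (Fin n)

theorem IsCpManifold.exists_normal_field (h : IsCpManifold n 2 d M) :
    ∃ (Ω : Set 𝔼) (v : 𝔼 → 𝔼), IsOpen Ω ∧ M ⊆ Ω ∧ ContDiffOn ℝ 1 v Ω ∧
      ∀ x ∈ M, v x = 0 ∧ fderiv ℝ v x = (normalSp n M x).starProjection := by
  rcases M.eq_empty_or_nonempty with rfl | hne
  · exact ⟨∅, 0, isOpen_empty, le_rfl, fun x hx => hx.elim, fun x hx => hx.elim⟩
  have key : ∀ x, ∃ (U : Set 𝔼) (v : 𝔼 → 𝔼), x ∈ M → IsOpen U ∧ x ∈ U ∧ ContDiffOn ℝ 1 v U ∧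
      ∀ x ∈ M ∩ U, v x = 0 ∧ fderiv ℝ v x = (normalSp n M x).starProjection := by
    intro x
    by_cases hx : x ∈ M
    · obtain ⟨U, v, h⟩ := h.exists_local_normal_field hx
      exact ⟨U, v, fun _ => h⟩
    · exact ⟨∅, 0, fun h => absurd h hx⟩
  choose U v hUv using key
  obtain ⟨c, w, hcM, hwc, hws, hwU, hw0, hwp⟩ := exists_bump_cover hne (U := U)
    (fun x hx => (hUv x hx).1.mem_nhds (hUv x hx).2.1)
  have hvat : ∀ k, ∀ y ∈ U (c k), ContDiffAt ℝ 1 (v (c k)) y := fun k y hy =>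
    (hUv _ (hcM k)).2.2.1.contDiffAt ((hUv _ (hcM k)).1.mem_nhds hy)
  obtain ⟨D, N, hD, hN, hDpos, hDN⟩ := exists_glued_field hwc hws hwU hw0 hvat
  have hDM : ∀ x ∈ M, 0 < D x := fun x hx => (hwp x hx).elim fun k hk => hDpos x k hk
  refine ⟨{y | 0 < D y}, fun y => (D y)⁻¹ • N y, isOpen_lt continuous_const hD.continuous, hDM,
    fun y hy => ((hD.contDiffAt.inv (ne_of_gt hy)).smul hN.contDiffAt).contDiffWithinAt,
    fun x hx => ?_⟩
  obtain ⟨hN0, hN1⟩ := hDN x (normalSp n M x).starProjection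
    fun k hk => (hUv _ (hcM k)).2.2.2 x ⟨hx, hk⟩
  refine ⟨by simp [hN0], ?_⟩
  have hdi : DifferentiableAt ℝ (fun y => (D y)⁻¹) x :=
    (hD.differentiable one_ne_zero x).inv (hDM x hx).ne'
  rw [(hdi.hasFDerivAt.fun_smul hN1).fderiv, hN0]
  ext1 z
  simp [(hDM x hx).ne']

theorem IsCpManifold.inner_eq_zero_of_isLocalMin (h : IsCpManifold n 2 d M) {x y : 𝔼}
    (hx : x ∈ M) (hmin : ∀ᶠ z in 𝓝 x, z ∈ M → ‖y - x‖ ≤ ‖y - z‖) : y - x ∈ normalSp n M x := by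
  rw [normalSp, Submodule.mem_orthogonal']
  intro w hw
  obtain ⟨γ, rfl, hγ, hγM⟩ := h.exists_curve hx hw
  have hd : HasDerivAt (fun t => ‖y - γ t‖ ^ 2) _ 0 := (hγ.const_sub y).norm_sq
  have hl : IsLocalMin (fun t => ‖y - γ t‖ ^ 2) 0 := by
    filter_upwards [hγM, hγ.continuousAt.eventually hmin] with t ht ht'
    exact pow_le_pow_left₀ (norm_nonneg _) (ht' ht) 2
  have := hl.hasDerivAt_eq_zero hd
  simpa using this

theorem IsCpManifold.eventually_exists_nearest (h : IsCpManifold n 2 d M) {G Ω : Set 𝔼}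
    (hG : IsOpen G) (hcl : closure M ∩ G ⊆ M) (hΩ : IsOpen Ω) {v : 𝔼 → 𝔼}
    (hv : ContDiffOn ℝ 1 v Ω)
    (hvM : ∀ x ∈ M, v x = 0 ∧ fderiv ℝ v x = (normalSp n M x).starProjection)
    {x₀ : 𝔼} (hx₀ : x₀ ∈ M) (hxG : x₀ ∈ G) (hxΩ : x₀ ∈ Ω) {t : ℝ} (ht : 0 < t) :
    ∀ᶠ y in 𝓝 x₀, ∃ x ∈ M, ‖y - x‖ ≤ t ∧ y - x ∈ normalSp n M x ∧
      ‖fderiv ℝ v y - (normalSp n M x).starProjection‖ ≤ t ∧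
      ‖v y - (y - x)‖ ≤ t * ‖y - x‖ := by
  have hvc : ContinuousAt (fderiv ℝ v) x₀ :=
    (hv.continuousOn_fderiv_of_isOpen hΩ le_rfl).continuousAt (hΩ.mem_nhds hxΩ)
  have hmem : G ∩ Ω ∩ fderiv ℝ v ⁻¹' closedBall (fderiv ℝ v x₀) (t / 2) ∈ 𝓝 x₀ :=
    inter_mem (inter_mem (hG.mem_nhds hxG) (hΩ.mem_nhds hxΩ))
      (hvc.preimage_mem_nhds (closedBall_mem_nhds _ (half_pos ht)))
  obtain ⟨ρ', hρ', hball⟩ := nhds_basis_closedBall.mem_iff.1 hmem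
  set ρ := min (ρ' / 2) t with hρdef
  have hρ : 0 < ρ := lt_min (half_pos hρ') ht
  have hsub : closedBall x₀ (2 * ρ) ⊆ closedBall x₀ ρ' :=
    closedBall_subset_closedBall (by linarith [min_le_left (ρ' / 2) t])
  have hK : IsCompact (M ∩ closedBall x₀ (2 * ρ)) := by
    have : M ∩ closedBall x₀ (2 * ρ) = closure M ∩ closedBall x₀ (2 * ρ) := by
      refine Set.Subset.antisymm (Set.inter_subset_inter_left _ subset_closure) ?_
      rintro z ⟨hz, hzb⟩
      exact ⟨hcl ⟨hz, (hball (hsub hzb)).1.1⟩, hzb⟩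
    rw [this]
    exact (isCompact_closedBall _ _).inter_left isClosed_closure
  filter_upwards [ball_mem_nhds x₀ hρ] with y hy
  obtain ⟨x, ⟨hxM, hxb⟩, hxmin⟩ := hK.exists_isMinOn ⟨x₀, hx₀, mem_closedBall_self (by positivity)⟩
    (f := fun x => ‖y - x‖) (by fun_prop)
  have hyx₀ : ‖y - x₀‖ < ρ := mem_ball_iff_norm.1 hy
  have hyx : ‖y - x‖ < ρ :=
    (isMinOn_iff.1 hxmin x₀ ⟨hx₀, mem_closedBall_self (by positivity)⟩).trans_lt hyx₀
  have hxball : x ∈ ball x₀ (2 * ρ) := by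
    rw [mem_ball_iff_norm]
    calc ‖x - x₀‖ = ‖(y - x₀) - (y - x)‖ := by congr 1; abel
      _ ≤ ‖y - x₀‖ + ‖y - x‖ := norm_sub_le _ _
      _ < 2 * ρ := by linarith
  have hyball : y ∈ ball x₀ (2 * ρ) := mem_ball_iff_norm.2 (by linarith)
  have hclose : ∀ z ∈ ball x₀ (2 * ρ), ‖fderiv ℝ v z - fderiv ℝ v x‖ ≤ t := fun z hz => by
    have h1 := mem_closedBall.1 (hball (hsub (ball_subset_closedBall hz))).2
    have h2 := mem_closedBall.1 (hball (hsub (ball_subset_closedBall hxball))).2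
    rw [← dist_eq_norm]
    linarith [dist_triangle_right (fderiv ℝ v z) (fderiv ℝ v x) (fderiv ℝ v x₀)]
  have hnor : y - x ∈ normalSp n M x := by
    refine h.inner_eq_zero_of_isLocalMin hxM ?_
    filter_upwards [isOpen_ball.mem_nhds hxball] with z hz hzM
    exact hxmin ⟨hzM, ball_subset_closedBall hz⟩
  refine ⟨x, hxM, hyx.le.trans (min_le_right _ _), hnor, ?_, ?_⟩
  · rw [← (hvM x hxM).2]
    exact hclose y hyball
  · have := (convex_ball x₀ (2 * ρ)).norm_image_sub_le_of_norm_fderiv_le' (f := v)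
      (φ := fderiv ℝ v x) (C := t)
      (fun z hz => (hv.differentiableOn one_ne_zero).differentiableAt
        (hΩ.mem_nhds (hball (hsub (ball_subset_closedBall hz))).1.2)) hclose hxball hyball
    rwa [(hvM x hxM).1, sub_zero, (hvM x hxM).2,
      Submodule.starProjection_eq_self_iff.2 hnor] at this

end NormalField

section TubeEstimate

variable {E : Type*} [NormedAddCommGroup E] [InnerProductSpace ℝ E]

theorem fderiv_tube_estimate {v : E → E} {r : E → ℝ} {x y : E} {t : ℝ}
    {N : Submodule ℝ E} [N.HasOrthogonalProjection] (hv : ContDiffAt ℝ 1 v y)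
    (hr : ContDiffAt ℝ 1 r y) (hr0 : 0 < r y) (hr1 : ‖fderiv ℝ r y‖ ≤ 1) (ht : t ≤ 1 / 2)
    (hN : y - x ∈ N) (hv1 : ‖fderiv ℝ v y - N.starProjection‖ ≤ t)
    (hv0 : ‖v y - (y - x)‖ ≤ t * ‖y - x‖) :
    ‖fderiv ℝ (fun y => y - tubeCutoff v r y • v y) y‖ ≤ 13 ∧
      ∀ w, ∃ u ∈ N, ‖u‖ ≤ 7 * ‖w‖ ∧
        ‖fderiv ℝ (fun y => y - tubeCutoff v r y • v y) y w - w - u‖ ≤ 7 * t * ‖w‖ := by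
  have hvd := (hv.differentiableAt one_ne_zero).hasFDerivAt
  have hrd := (hr.differentiableAt one_ne_zero).hasFDerivAt
  have hφd := ((contDiffAt_tubeCutoff hv hr hr0).differentiableAt one_ne_zero).hasFDerivAt
  set φ := tubeCutoff v r with hφ
  have hD := (hasFDerivAt_id y).fun_sub (hφd.fun_smul hvd)
  simp only [id] at hD
  rw [hD.fderiv]
  set v' := fderiv ℝ v y
  set p := N.starProjection
  have hp : ‖p‖ ≤ 1 := N.starProjection_norm_le
  have hv' : ‖v'‖ ≤ 3 / 2 := by
    have := norm_le_norm_add_norm_sub' v' p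
    linarith
  have hφ0 : 0 ≤ φ y := tubeCutoff_nonneg v r y
  have hφ1 : φ y ≤ 1 := tubeCutoff_le_one v r y
  have hφv : ∀ w, |fderiv ℝ φ y w| * ‖v y‖ ≤ 3 * ‖w‖ :=
    abs_fderiv_tubeCutoff_mul_norm_le hvd hrd hr0 hv' hr1
  have hyx : ‖y - x‖ ≤ 2 * ‖v y‖ := by
    have h1 := norm_le_norm_add_norm_sub' (y - x) (v y)
    rw [norm_sub_rev _ (v y)] at h1
    nlinarith [norm_nonneg (y - x)]
  have hφyx : ∀ w, |fderiv ℝ φ y w| * ‖y - x‖ ≤ 6 * ‖w‖ := fun w => by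
    nlinarith [hφv w, mul_le_mul_of_nonneg_left hyx (abs_nonneg (fderiv ℝ φ y w))]
  refine ⟨ContinuousLinearMap.opNorm_le_bound _ (by norm_num) fun w => ?_, fun w =>
    ⟨-(φ y • p w) - fderiv ℝ φ y w • (y - x), ?_, ?_, ?_⟩⟩
  · have e : (ContinuousLinearMap.id ℝ E - (φ y • v' + (fderiv ℝ φ y).smulRight (v y))) w =
        w - φ y • v' w - fderiv ℝ φ y w • v y := by simp; abel
    rw [e]
    have h1 : ‖φ y • v' w‖ ≤ 3 / 2 * ‖w‖ := by
      rw [norm_smul, Real.norm_of_nonneg hφ0]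
      nlinarith [v'.le_of_opNorm_le hv' w, norm_nonneg (v' w)]
    have h2 : ‖fderiv ℝ φ y w • v y‖ ≤ 3 * ‖w‖ := by
      rw [norm_smul]
      exact hφv w
    have h3 := norm_sub_le (w - φ y • v' w) (fderiv ℝ φ y w • v y)
    have h4 := norm_sub_le w (φ y • v' w)
    linarith [norm_nonneg w]
  · exact N.sub_mem (N.neg_mem (N.smul_mem _ (N.starProjection_apply_mem w))) (N.smul_mem _ hN)
  · have h1 : ‖-(φ y • p w)‖ ≤ ‖w‖ := by
      rw [norm_neg, norm_smul, Real.norm_of_nonneg hφ0]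
      nlinarith [p.le_of_opNorm_le hp w, norm_nonneg (p w)]
    have h2 : ‖fderiv ℝ φ y w • (y - x)‖ ≤ 6 * ‖w‖ := by
      rw [norm_smul]
      exact hφyx w
    have h3 := norm_sub_le (-(φ y • p w)) (fderiv ℝ φ y w • (y - x))
    linarith
  · have e : (ContinuousLinearMap.id ℝ E - (φ y • v' + (fderiv ℝ φ y).smulRight (v y))) w - w -
        (-(φ y • p w) - fderiv ℝ φ y w • (y - x)) =
        -(φ y • (v' - p) w) - fderiv ℝ φ y w • (v y - (y - x)) := by
      simp [smul_sub]; abel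
    rw [e]
    have h1 : ‖-(φ y • (v' - p) w)‖ ≤ t * ‖w‖ := by
      rw [norm_neg, norm_smul, Real.norm_of_nonneg hφ0]
      nlinarith [(v' - p).le_of_opNorm_le hv1 w, norm_nonneg ((v' - p) w)]
    have h2 : ‖fderiv ℝ φ y w • (v y - (y - x))‖ ≤ 6 * t * ‖w‖ := by
      have ht0 : 0 ≤ t := (norm_nonneg _).trans hv1
      rw [norm_smul]
      calc |fderiv ℝ φ y w| * ‖v y - (y - x)‖ ≤ |fderiv ℝ φ y w| * (t * ‖y - x‖) := by gcongr
        _ = t * (|fderiv ℝ φ y w| * ‖y - x‖) := by ring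
        _ ≤ t * (6 * ‖w‖) := mul_le_mul_of_nonneg_left (hφyx w) ht0
        _ = 6 * t * ‖w‖ := by ring
    have h3 := norm_sub_le (-(φ y • (v' - p) w)) (fderiv ℝ φ y w • (v y - (y - x)))
    linarith

theorem norm_tubeCutoff_smul_le {v : E → E} {r : E → ℝ} {y : E} (hr : 0 < r y) :
    ‖tubeCutoff v r y • v y‖ ≤ r y := by
  rcases le_total (r y) ‖v y‖ with h | h
  · rw [tubeCutoff_eq_zero hr h]
    simpa using hr.le
  · rw [norm_smul, Real.norm_of_nonneg (tubeCutoff_nonneg v r y)]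
    nlinarith [tubeCutoff_le_one v r y, tubeCutoff_nonneg v r y, norm_nonneg (v y)]

theorem fderiv_tube_eq {v : E → E} {r : E → ℝ} {y : E} (hv : ContDiffAt ℝ 1 v y)
    (hr : ContDiffAt ℝ 1 r y) (hr0 : 0 < r y) (h0 : v y = 0) :
    fderiv ℝ (fun y => y - tubeCutoff v r y • v y) y =
      ContinuousLinearMap.id ℝ E - fderiv ℝ v y := by
  have hvd := (hv.differentiableAt one_ne_zero).hasFDerivAt
  have hφd := ((contDiffAt_tubeCutoff hv hr hr0).differentiableAt one_ne_zero).hasFDerivAt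
  have hD := (hasFDerivAt_id y).fun_sub (hφd.fun_smul hvd)
  simp only [id] at hD
  rw [hD.fderiv, tubeCutoff_eq_one h0, h0]
  ext1 w
  simp

end TubeEstimate

section TubeMap

variable {n d : ℕ} {M : Set (EuclideanSpace ℝ (Fin n))}

local notation "𝔼" => EuclideanSpace ℝ (Fin n)

theorem IsCpManifold.exists_tube_map (h : IsCpManifold n 2 d M) {G W : Set 𝔼} (hG : IsOpen G)
    (hW : IsOpen W) (hMW : M ⊆ W) (hWG : W ⊆ G) (hcl : closure M ∩ G ⊆ M) {P : 𝔼 → ℝ → Prop}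
    (hP : ∀ x ∈ W, ∃ c > 0, ∀ᶠ y in 𝓝 x, ∀ t, 0 < t → t ≤ c → P y t) :
    ∃ Φ : 𝔼 → 𝔼, (∀ y ∈ G, ContDiffAt ℝ 1 Φ y) ∧
      (∀ y ∉ W, Φ y = y ∧ (y ∈ G → fderiv ℝ Φ y = .id ℝ 𝔼)) ∧
      (∀ x ∈ M, Φ x = x ∧ ∀ u ∈ normalSp n M x, fderiv ℝ Φ x u = 0) ∧
      (∀ y, Φ y = y ∨ ∃ t, P y t ∧ ‖Φ y - y‖ ≤ t) ∧
      ∀ y ∈ G, ‖fderiv ℝ Φ y‖ ≤ 13 ∧ (fderiv ℝ Φ y = .id ℝ 𝔼 ∨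
        ∃ t > 0, P y t ∧ ∃ x ∈ M, ‖y - x‖ ≤ t ∧ ∀ w, ∃ u ∈ normalSp n M x,
          ‖u‖ ≤ 7 * ‖w‖ ∧ ‖fderiv ℝ Φ y w - w - u‖ ≤ 7 * t * ‖w‖) := by
  classical
  obtain ⟨Ω₀, v, hΩ₀, hMΩ₀, hv, hvM⟩ := h.exists_normal_field
  set S : Set 𝔼 := {y | ∃ x ∈ M, ∃ t > 0, t ≤ 1 / 2 ∧ P y t ∧ ‖y - x‖ ≤ t ∧
    y - x ∈ normalSp n M x ∧ ‖fderiv ℝ v y - (normalSp n M x).starProjection‖ ≤ t ∧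
    ‖v y - (y - x)‖ ≤ t * ‖y - x‖} with hS
  set Ω := Ω₀ ∩ W ∩ interior S with hΩdef
  have hΩ : IsOpen Ω := (hΩ₀.inter hW).inter isOpen_interior
  have hΩW : Ω ⊆ W := fun y hy => hy.1.2
  have hMΩ : M ⊆ Ω := fun x hx => by
    refine ⟨⟨hMΩ₀ hx, hMW hx⟩, mem_interior_iff_mem_nhds.2 ?_⟩
    obtain ⟨c, hc, hPc⟩ := hP x (hMW hx)
    filter_upwards [hPc, h.eventually_exists_nearest hG hcl hΩ₀ hv hvM hx (hWG (hMW hx)) (hMΩ₀ hx)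
      (lt_min hc one_half_pos)] with y hy ⟨z, hz, hz'⟩
    exact ⟨z, hz, _, lt_min hc one_half_pos, min_le_right _ _,
      hy _ (lt_min hc one_half_pos) (min_le_left _ _), hz'⟩
  have hvat : ∀ y ∈ Ω, ContDiffAt ℝ 1 v y := fun y hy => hv.contDiffAt (hΩ₀.mem_nhds hy.1.1)
  have hΩS : ∀ y ∈ Ω, y ∈ S := fun y hy => interior_subset hy.2
  obtain ⟨r, hr, hrΩ, hr0, hr1⟩ := exists_contDiff_regulator hΩ
    (fun x hx => hP x (hΩW hx)) one_pos
  set Ψ : 𝔼 → 𝔼 := fun y => y - tubeCutoff v r y • v y with hΨ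
  have hΨd : ∀ y ∈ Ω, ContDiffAt ℝ 1 Ψ y := fun y hy => contDiffAt_id.sub
    ((contDiffAt_tubeCutoff (hvat y hy) hr.contDiffAt (hrΩ y hy).1).smul (hvat y hy))
  set Φ : 𝔼 → 𝔼 := fun y => if y ∈ Ω then Ψ y else y with hΦ
  have hΦΩ : ∀ y ∈ Ω, Φ =ᶠ[𝓝 y] Ψ := fun y hy => by
    filter_upwards [hΩ.mem_nhds hy] with z hz
    simp [hΦ, hz]
  have hΦid : ∀ y ∈ G, y ∉ Ω → Φ =ᶠ[𝓝 y] id := fun y hyG hy => by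
    rcases M.eq_empty_or_nonempty with rfl | hne
    · filter_upwards with z
      simp only [hΦ]
      split_ifs with hz
      · obtain ⟨x, hx, -⟩ := hΩS z hz
        exact hx.elim
      · rfl
    have hycl : y ∉ closure M := fun hyc => hy (hMΩ (hcl ⟨hyc, hyG⟩))
    have hd0 : 0 < infDist y M :=
      (infDist_pos_iff_notMem_closure hne).1 hycl
    have h1 : ∀ᶠ z in 𝓝 y, infDist y M / 2 < infDist z M :=
      (continuous_infDist_pt M).continuousAt.eventually (lt_mem_nhds (half_lt_self hd0))
    have h2 : ∀ᶠ z in 𝓝 y, r z < infDist y M / 4 :=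
      hr.continuous.continuousAt.eventually (gt_mem_nhds (by rw [hr0 y hy]; linarith))
    filter_upwards [h1, h2] with z hz1 hz2
    simp only [hΦ]
    split_ifs with hz
    · obtain ⟨x, hx, t, ht0, ht, -, -, -, -, hvz⟩ := hΩS z hz
      have h3 : infDist z M ≤ ‖z - x‖ := dist_eq_norm z x ▸ infDist_le_dist_of_mem hx
      have h4 := norm_le_norm_add_norm_sub' (z - x) (v z)
      rw [norm_sub_rev _ (v z)] at h4
      have : r z ≤ ‖v z‖ := by nlinarith [norm_nonneg (z - x)]
      simp [hΨ, tubeCutoff_eq_zero (hrΩ z hz).1 this]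
    · rfl
  have hfid : ∀ y ∈ G, y ∉ Ω → fderiv ℝ Φ y = .id ℝ 𝔼 := fun y hyG hy => by
    rw [(hΦid y hyG hy).fderiv_eq, fderiv_id]
  refine ⟨Φ, fun y hyG => ?_, fun y hy => ⟨?_, fun hyG => hfid y hyG fun hyΩ => hy (hΩW hyΩ)⟩,
    fun x hx => ⟨?_, fun u hu => ?_⟩, fun y => ?_, fun y hyG => ?_⟩
  · by_cases hy : y ∈ Ω
    · exact (hΨd y hy).congr_of_eventuallyEq (hΦΩ y hy)
    · exact contDiffAt_id.congr_of_eventuallyEq (hΦid y hyG hy)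
  · exact if_neg fun hyΩ => hy (hΩW hyΩ)
  · simp [hΦ, hΨ, (hvM x hx).1]
  · rw [(hΦΩ x (hMΩ hx)).fderiv_eq, fderiv_tube_eq (hvat x (hMΩ hx)) hr.contDiffAt
      (hrΩ x (hMΩ hx)).1 (hvM x hx).1, (hvM x hx).2]
    simp [Submodule.starProjection_eq_self_iff.2 hu]
  · by_cases hy : y ∈ Ω
    · refine .inr ⟨r y, (hrΩ y hy).2, ?_⟩
      simpa [hΦ, hΨ, hy] using norm_tubeCutoff_smul_le (v := v) (hrΩ y hy).1
    · exact .inl (by simp [hΦ, hy])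
  · by_cases hy : y ∈ Ω
    · obtain ⟨x, hx, t, ht0, ht, hPt, hyx, hN, hv1, hv0⟩ := hΩS y hy
      obtain ⟨e1, e2⟩ := fderiv_tube_estimate (hvat y hy) hr.contDiffAt (hrΩ y hy).1 (hr1 y) ht hN
        hv1 hv0
      rw [(hΦΩ y hy).fderiv_eq]
      exact ⟨e1, .inr ⟨t, ht0, hPt, x, hx, hyx, e2⟩⟩
    · rw [hfid y hyG hy]
      exact ⟨ContinuousLinearMap.norm_id_le.trans (by norm_num), .inl rfl⟩

end TubeMap

section SmallRadius

variable {E : Type*} [NormedAddCommGroup E]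

theorem exists_pos_of_eventually_prod_nhdsGT {P : E → ℝ → Prop} {x : E}
    (h : ∀ᶠ p in 𝓝 x ×ˢ 𝓝[>] (0 : ℝ), P p.1 p.2) :
    ∃ c > 0, ∀ᶠ y in 𝓝 x, ∀ t, 0 < t → t ≤ c → P y t := by
  obtain ⟨p, hp, q, hq, hpq⟩ := eventually_prod_iff.1 h
  obtain ⟨c, hc, hcq⟩ := mem_nhdsGT_iff_exists_Ioc_subset.1 hq
  exact ⟨c, hc, hp.mono fun y hy t h0 ht => hpq hy (hcq ⟨h0, ht⟩)⟩

theorem eventually_prod_nhdsGT_closedBall_subset {x : E} {U : Set E} (hU : U ∈ 𝓝 x) :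
    ∀ᶠ p in 𝓝 x ×ˢ 𝓝[>] (0 : ℝ), p.1 ∈ U ∧ closedBall p.1 p.2 ⊆ U := by
  obtain ⟨ρ, hρ, hρU⟩ := nhds_basis_closedBall.mem_iff.1 hU
  have h1 : ∀ᶠ y in 𝓝 x, y ∈ closedBall x (ρ / 2) := closedBall_mem_nhds _ (half_pos hρ)
  have h2 : ∀ᶠ t in 𝓝[>] (0 : ℝ), t ∈ Set.Ioc 0 (ρ / 2) := Ioc_mem_nhdsGT (half_pos hρ)
  filter_upwards [h1.prod_mk h2] with p ⟨hp1, hp2⟩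
  rw [mem_closedBall] at hp1
  have h : closedBall p.1 p.2 ⊆ U :=
    (closedBall_subset_closedBall' (by linarith [hp2.2])).trans hρU
  exact ⟨h (mem_closedBall_self hp2.1.le), h⟩

theorem eventually_prod_nhdsGT_abs_sub_lt {g ε : E → ℝ} (hg : Continuous g) (hε : Continuous ε)
    (hε0 : ∀ x, 0 < ε x) (x : E) :
    ∀ᶠ p in 𝓝 x ×ˢ 𝓝[>] (0 : ℝ), ∀ z ∈ closedBall p.1 p.2, |g z - g p.1| < ε p.1 := by
  have h1 : ∀ᶠ z in 𝓝 x, dist (g z) (g x) < ε x / 4 :=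
    Metric.tendsto_nhds.1 hg.continuousAt _ (by linarith [hε0 x])
  have h2 : ∀ᶠ z in 𝓝 x, ε x / 2 < ε z :=
    hε.continuousAt.eventually (lt_mem_nhds (half_lt_self (hε0 x)))
  filter_upwards [eventually_prod_nhdsGT_closedBall_subset (h1.and h2)] with p ⟨hp, hpU⟩ z hz
  have h3 := (hpU hz).1
  have h4 := hp.1
  have h5 := hp.2
  have h6 := dist_triangle_right (g z) (g p.1) (g x)
  rw [Real.dist_eq] at h6
  linarith

theorem eventually_prod_nhdsGT_disjoint {S V : Set E} (hS : IsClosed S) (hV : IsOpen V)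
    (hSV : S ⊆ V) (x : E) :
    ∀ᶠ p in 𝓝 x ×ˢ 𝓝[>] (0 : ℝ), p.1 ∉ V → ∀ z ∈ closedBall p.1 p.2, z ∉ S := by
  by_cases hx : x ∈ S
  · filter_upwards [eventually_prod_nhdsGT_closedBall_subset (hV.mem_nhds (hSV hx))]
      with p hp hpV using absurd hp.1 hpV
  · filter_upwards [eventually_prod_nhdsGT_closedBall_subset (hS.isOpen_compl.mem_nhds hx)]
      with p hp _ z hz using hp.2 hz

theorem eventually_prod_nhdsGT_le_norm_sub_sq {F : Set E} (hF : IsClosed F) {x : E} (hx : x ∉ F) :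
    ∀ᶠ p in 𝓝 x ×ˢ 𝓝[>] (0 : ℝ), ∀ z ∈ F, p.2 ≤ ‖p.1 - z‖ ^ 2 := by
  rcases F.eq_empty_or_nonempty with rfl | hne
  · exact Eventually.of_forall fun p z hz => hz.elim
  have h0 : 0 < infDist x F :=
    (infDist_pos_iff_notMem_closure hne).1 (by rwa [hF.closure_eq])
  have h1 : ∀ᶠ y in 𝓝 x, infDist x F / 2 < infDist y F :=
    (continuous_infDist_pt F).continuousAt.eventually (lt_mem_nhds (half_lt_self h0))
  have h2 : ∀ᶠ t in 𝓝[>] (0 : ℝ), t ∈ Set.Ioc 0 ((infDist x F / 2) ^ 2) :=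
    Ioc_mem_nhdsGT (by positivity)
  filter_upwards [h1.prod_mk h2] with p ⟨hp1, hp2⟩ z hz
  refine hp2.2.trans (pow_le_pow_left₀ (half_pos h0).le ?_ 2)
  exact hp1.le.trans (dist_eq_norm p.1 z ▸ infDist_le_dist_of_mem hz)

end SmallRadius

theorem exists_forall_abs_apply_le {E : Type*} [NormedAddCommGroup E] [NormedSpace ℝ E]
    [FiniteDimensional ℝ E] {M : Set E} {N : E → Submodule ℝ E} {L : E →L[ℝ] ℝ} {x₀ : E}
    (h : ∀ (x v : ℕ → E) (v' : E), (∀ k, x k ∈ M) → Tendsto x atTop (𝓝 x₀) →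
      (∀ k, v k ∈ N (x k)) → Tendsto v atTop (𝓝 v') → L v' = 0) {η : ℝ} (hη : 0 < η) :
    ∀ᶠ x in 𝓝 x₀, x ∈ M → ∀ u ∈ N x, |L u| ≤ η * ‖u‖ := by
  by_contra hcon
  have hf : ∃ᶠ x in 𝓝 x₀, x ∈ M ∧ ∃ u ∈ N x, η * ‖u‖ < |L u| := by
    refine (not_eventually.1 hcon).mono fun x hx => ?_
    push Not at hx
    exact hx
  obtain ⟨x, hx, hxM⟩ := exists_seq_forall_of_frequently hf
  choose hxM u hu hLu using hxM
  have hu0 : ∀ k, 0 < ‖u k‖ := fun k => norm_pos_iff.2 fun h0 => by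
    have := hLu k
    simp [h0] at this
  set v : ℕ → E := fun k => ‖u k‖⁻¹ • u k with hv
  have hv1 : ∀ k, v k ∈ sphere (0 : E) 1 := fun k => by
    rw [mem_sphere_zero_iff_norm, hv, norm_smul, norm_inv, norm_norm,
      inv_mul_cancel₀ (hu0 k).ne']
  obtain ⟨v', -, φ, hφ, hlim⟩ := (isCompact_sphere (0 : E) 1).tendsto_subseq hv1
  have hL0 := h (x ∘ φ) (v ∘ φ) v' (fun k => hxM _) (hx.comp hφ.tendsto_atTop)
    (fun k => (N _).smul_mem _ (hu _)) hlim
  have hLv : ∀ k, η ≤ |L (v k)| := fun k => by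
    rw [hv, map_smul, smul_eq_mul, abs_mul, abs_inv, abs_norm, inv_mul_eq_div,
      le_div_iff₀ (hu0 k)]
    exact (hLu k).le
  have := ge_of_tendsto' ((L.continuous.tendsto v').comp hlim).abs fun k => hLv (φ k)
  rw [hL0, abs_zero] at this
  linarith

theorem IsCpManifold.exists_approx_step {n d : ℕ} {M K : Set (EuclideanSpace ℝ (Fin n))}
    (h : IsCpManifold n 2 d M) (hK : IsClosed K) (hMK : Disjoint M K) (hcl : closure M ⊆ M ∪ K)
    {g ε : EuclideanSpace ℝ (Fin n) → ℝ} (hg : ContDiff ℝ 1 g) (hε : Continuous ε)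
    (hε0 : ∀ x, 0 < ε x) {V : Set (EuclideanSpace ℝ (Fin n))} (hV : IsOpen V)
    (hgV : tsupport g ⊆ V)
    (hWh : ∀ x₀ ∈ K, ∀ (x v : ℕ → EuclideanSpace ℝ (Fin n)) (v' : EuclideanSpace ℝ (Fin n)),
      (∀ k, x k ∈ M) → Tendsto x atTop (𝓝 x₀) → (∀ k, v k ∈ normalSp n M (x k)) →
        Tendsto v atTop (𝓝 v') → fderiv ℝ g x₀ v' = 0) :
    ∃ g₂ : EuclideanSpace ℝ (Fin n) → ℝ, ContDiff ℝ 1 g₂ ∧ (∀ x, |g₂ x - g x| < ε x) ∧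
      tsupport g₂ ⊆ V ∧ (∀ x ∈ M, ∀ u ∈ normalSp n M x, fderiv ℝ g₂ x u = 0) ∧
      (∀ x ∈ K, fderiv ℝ g₂ x = fderiv ℝ g x) ∧
      ∀ κ : NNReal, LipschitzWith κ g → LipschitzWith (13 * κ) g₂ := by
  obtain ⟨V', hV', hgV', hV'V⟩ := normal_exists_closure_subset (isClosed_tsupport g) hV hgV
  set F := closure M ∩ K with hFdef
  have hF : IsClosed F := isClosed_closure.inter hK
  have hMF : ∀ x ∈ M, x ∈ Fᶜ := fun x hx hxF => Set.disjoint_left.1 hMK hx hxF.2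
  obtain ⟨Φ, hΦc, hΦK, hΦM, hΦt, hΦd⟩ := h.exists_tube_map
    (P := fun y t => (∀ z ∈ closedBall y t, |g z - g y| < ε y) ∧
      (y ∉ V' → ∀ z ∈ closedBall y t, z ∉ tsupport g) ∧ ∀ z ∈ F, t ≤ ‖y - z‖ ^ 2)
    hF.isOpen_compl hK.isOpen_compl
    (Set.disjoint_left.1 hMK) (fun x hx hxF => hx hxF.2)
    (fun x hx => (hcl hx.1).resolve_right fun hxK => hx.2 ⟨hx.1, hxK⟩)
    (fun x hx => exists_pos_of_eventually_prod_nhdsGT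
      ((eventually_prod_nhdsGT_abs_sub_lt hg.continuous hε hε0 x).and
        ((eventually_prod_nhdsGT_disjoint (isClosed_tsupport g) hV' hgV' x).and
          (eventually_prod_nhdsGT_le_norm_sub_sq hF fun hxF => hx hxF.2))))
  have hsq : ∀ x ∈ F, ∀ y, ‖Φ y - y‖ ≤ ‖y - x‖ ^ 2 := fun x hx y => by
    rcases hΦt y with h | ⟨t, hP, ht⟩
    · simp [h]
    · exact ht.trans (hP.2.2 x hx)
  have hΦF : ∀ x ∈ F, HasFDerivAt Φ (.id ℝ _) x := fun x hx => by
    refine HasFDerivAt.of_isLittleO ?_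
    rw [(hΦK x fun hxK => hxK hx.2).1]
    refine Asymptotics.IsBigO.trans_isLittleO (g := fun y => ‖y - x‖ ^ 2)
      (Asymptotics.IsBigO.of_bound 1 (Eventually.of_forall fun y => ?_)) ?_
    · have e : Φ y - x - ContinuousLinearMap.id ℝ _ (y - x) = Φ y - y := by simp
      rw [e, one_mul, Real.norm_of_nonneg (by positivity)]
      exact hsq x hx y
    · exact Asymptotics.isLittleO_pow_sub_sub x one_lt_two
  have hΦdiff : ∀ y, DifferentiableAt ℝ Φ y := fun y => by
    by_cases hy : y ∈ F
    · exact (hΦF y hy).differentiableAt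
    · exact (hΦc y hy).differentiableAt one_ne_zero
  have hΦ13 : ∀ y, ‖fderiv ℝ Φ y‖ ≤ 13 := fun y => by
    by_cases hy : y ∈ F
    · rw [(hΦF y hy).fderiv]
      exact ContinuousLinearMap.norm_id_le.trans (by norm_num)
    · exact (hΦd y hy).1
  have hgd := hg.differentiable one_ne_zero
  have hcomp : ∀ y, fderiv ℝ (fun y => g (Φ y)) y = (fderiv ℝ g (Φ y)) ∘L fderiv ℝ Φ y := fun y =>
    ((hgd (Φ y)).hasFDerivAt.comp y (hΦdiff y).hasFDerivAt).fderiv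
  have hKd : ∀ x ∈ K, fderiv ℝ (fun y => g (Φ y)) x = fderiv ℝ g x := fun x hx => by
    have e : fderiv ℝ Φ x = .id ℝ _ := by
      by_cases hxF : x ∈ F
      · exact (hΦF x hxF).fderiv
      · exact (hΦK x fun h => h hx).2 hxF
    rw [hcomp, e, (hΦK x fun h => h hx).1]
    rfl
  refine ⟨fun y => g (Φ y), contDiff_one_iff_fderiv.2 ⟨fun y =>
    (hgd (Φ y)).comp y (hΦdiff y), continuous_iff_continuousAt.2 fun x => ?_⟩, fun x => ?_, ?_,
    fun x hx u hu => ?_, hKd, fun κ hκ => ?_⟩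
  · by_cases hx : x ∈ F
    swap
    · exact (hg.contDiffAt.comp x (hΦc x hx)).fderiv_right (m := 0) le_rfl |>.continuousAt
    set L := fderiv ℝ g x
    have hΦx : Tendsto Φ (𝓝 x) (𝓝 x) := by
      simpa [ContinuousAt, (hΦK x fun h => h hx.2).1] using (hΦdiff x).continuousAt
    have hA : Tendsto (fun y => (fderiv ℝ g (Φ y) - L) ∘L fderiv ℝ Φ y) (𝓝 x) (𝓝 0) := by
      have h0 : Tendsto (fun y => ‖fderiv ℝ g (Φ y) - L‖ * 13) (𝓝 x) (𝓝 0) := by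
        simpa [L] using ((((hg.continuous_fderiv one_ne_zero).tendsto x).comp hΦx).sub_const
          L).norm.mul_const 13
      exact squeeze_zero_norm (fun y => (ContinuousLinearMap.opNorm_comp_le _ _).trans
        (mul_le_mul_of_nonneg_left (hΦ13 y) (norm_nonneg _))) h0
    have hB : Tendsto (fun y => L ∘L fderiv ℝ Φ y) (𝓝 x) (𝓝 L) := by
      refine Metric.tendsto_nhds.2 fun η' hη' => ?_
      obtain ⟨η, hη, hηη'⟩ : ∃ η > 0, 7 * η + ‖L‖ * (7 * η) < η' :=
        ⟨η' / (8 * (1 + ‖L‖)), by positivity, by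
          rw [show 7 * (η' / (8 * (1 + ‖L‖))) + ‖L‖ * (7 * (η' / (8 * (1 + ‖L‖)))) = 7 / 8 * η' by
            field_simp]
          linarith⟩
      obtain ⟨δ, hδ, hδL⟩ := Metric.eventually_nhds_iff.1
        (exists_forall_abs_apply_le (hWh x hx.2) hη)
      have hsmall : ∀ᶠ y in 𝓝 x, ‖y - x‖ + ‖y - x‖ ^ 2 < δ ∧ ‖y - x‖ ^ 2 < η := by
        have h1 : ContinuousAt (fun y => ‖y - x‖ + ‖y - x‖ ^ 2) x := by fun_prop
        have h2 : ContinuousAt (fun y => ‖y - x‖ ^ 2) x := by fun_prop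
        exact (h1.eventually (gt_mem_nhds (by simpa using hδ))).and
          (h2.eventually (gt_mem_nhds (by simpa using hη)))
      filter_upwards [hsmall] with y ⟨hy1, hy2⟩
      rw [dist_eq_norm]
      refine lt_of_le_of_lt ?_ hηη'
      have hid : fderiv ℝ Φ y = .id ℝ _ → ‖L ∘L fderiv ℝ Φ y - L‖ ≤ 7 * η + ‖L‖ * (7 * η) :=
        fun e => by
          rw [e, ContinuousLinearMap.comp_id, sub_self, norm_zero]
          positivity
      by_cases hyF : y ∈ F
      · exact hid (hΦF y hyF).fderiv
      obtain e | ⟨t, ht, hP, z, hz, hyz, hu⟩ := (hΦd y hyF).2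
      · exact hid e
      have hty : t ≤ ‖y - x‖ ^ 2 := hP.2.2 x hx
      have hzx : dist z x < δ := by
        have := dist_triangle z y x
        rw [dist_comm z y, dist_eq_norm y z, dist_eq_norm y x] at this
        linarith
      refine ContinuousLinearMap.opNorm_le_bound _ (by positivity) fun w => ?_
      obtain ⟨u, huN, huw, huΦ⟩ := hu w
      have e : (L ∘L fderiv ℝ Φ y - L) w = L u + L (fderiv ℝ Φ y w - w - u) := by
        simp
      have h1 : ‖L u‖ ≤ 7 * η * ‖w‖ := (hδL hzx hz u huN).trans (by nlinarith)
      have h2 : ‖L (fderiv ℝ Φ y w - w - u)‖ ≤ ‖L‖ * (7 * η * ‖w‖) :=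
        L.le_opNorm_of_le (huΦ.trans (by gcongr; linarith))
      rw [e]
      linarith [norm_add_le (L u) (L (fderiv ℝ Φ y w - w - u))]
    have hAB := hA.add hB
    rw [zero_add] at hAB
    rw [ContinuousAt, hKd x hx.2]
    refine hAB.congr fun y => ?_
    rw [hcomp, ContinuousLinearMap.sub_comp, sub_add_cancel]
  · rcases hΦt x with h | ⟨t, hP, ht⟩
    · simpa [h] using hε0 x
    · exact hP.1 _ (by rwa [mem_closedBall, dist_eq_norm])
  · refine (closure_mono fun y hy => ?_).trans hV'V
    by_contra hyV
    have hy' : Φ y ∈ tsupport g := subset_tsupport g hy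
    rcases hΦt y with h | ⟨t, hP, ht⟩
    · exact hyV (hgV' (h ▸ hy'))
    · exact hP.2.1 hyV _ (by rwa [mem_closedBall, dist_eq_norm]) hy'
  · rw [hcomp, ContinuousLinearMap.comp_apply, (hΦM x hx).2 u hu, map_zero]
  · refine lipschitzWith_of_nnnorm_fderiv_le (fun y => (hgd (Φ y)).comp y (hΦdiff y)) fun y => ?_
    rw [← NNReal.coe_le_coe, coe_nnnorm, hcomp, NNReal.coe_mul, mul_comm]
    exact (ContinuousLinearMap.opNorm_comp_le _ _).trans (mul_le_mul
      (norm_fderiv_le_of_lipschitz ℝ hκ) (hΦ13 y) (norm_nonneg _) κ.2)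

section Mollify

variable {E : Type*} [NormedAddCommGroup E] [InnerProductSpace ℝ E] [FiniteDimensional ℝ E]

open MeasureTheory in
theorem exists_mollification_s1 {f : E → ℝ} (hf : Continuous f) {t : ℝ} (ht : 0 < t) :
    ∃ h : E → ℝ, ContDiff ℝ 1 h ∧
      (∀ x η, (∀ z ∈ closedBall x t, |f z - f x| ≤ η) → |h x - f x| ≤ η) ∧
      ∀ κ : NNReal, LipschitzWith κ f → LipschitzWith κ h := by
  borelize E
  let φ : ContDiffBump (0 : E) := ⟨t / 2, t, half_pos ht, half_lt_self ht⟩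
  have hφi : ∀ x, Integrable (fun z => φ.normed volume z * f (x - z)) := fun x =>
    (φ.hasCompactSupport_normed.convolutionExists_left (ContinuousLinearMap.lsmul ℝ ℝ)
      φ.continuous_normed (hf.locallyIntegrable (μ := volume)) x).integrable
  refine ⟨convolution (φ.normed volume) f (ContinuousLinearMap.lsmul ℝ ℝ) volume,
    φ.hasCompactSupport_normed.contDiff_convolution_left _ φ.contDiff_normed
      hf.locallyIntegrable, fun x η h => ?_, fun κ hκ => ?_⟩
  · rw [← Real.dist_eq]
    exact φ.dist_normed_convolution_le hf.aestronglyMeasurable fun z hz => by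
      rw [Real.dist_eq]
      exact h z (ball_subset_closedBall hz)
  · refine LipschitzWith.of_dist_le_mul fun x y => ?_
    rw [dist_eq_norm, convolution_def, convolution_def]
    simp only [ContinuousLinearMap.lsmul_apply, smul_eq_mul]
    rw [← integral_sub (hφi x) (hφi y)]
    calc ‖∫ z, φ.normed volume z * f (x - z) - φ.normed volume z * f (y - z)‖
        ≤ ∫ z, φ.normed volume z * (κ * dist x y) := by
          refine norm_integral_le_of_norm_le (φ.integrable_normed.mul_const _)
            (Eventually.of_forall fun z => ?_)
          rw [← mul_sub, norm_mul, Real.norm_of_nonneg (φ.nonneg_normed z)]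
          refine mul_le_mul_of_nonneg_left ?_ (φ.nonneg_normed z)
          have := hκ.dist_le_mul (x - z) (y - z)
          rwa [dist_sub_right, dist_eq_norm] at this
      _ = κ * dist x y := by
          rw [integral_mul_const, φ.integral_normed, one_mul]

end Mollify

theorem IsCompact.exists_pos_forall_of_eventually_prod_nhdsGT {E : Type*} [NormedAddCommGroup E]
    {K : Set E} (hK : IsCompact K) {P : E → ℝ → Prop}
    (h : ∀ x ∈ K, ∀ᶠ p in 𝓝 x ×ˢ 𝓝[>] (0 : ℝ), P p.1 p.2) :
    ∃ c > 0, ∀ t, 0 < t → t ≤ c → ∀ x ∈ K, P x t := by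
  have h' : ∀ᶠ t in 𝓝 (0 : ℝ), ∀ x ∈ K, 0 < t → P x t :=
    hK.eventually_forall_of_forall_eventually fun x hx => by
      obtain ⟨c, hc, hcP⟩ := exists_pos_of_eventually_prod_nhdsGT (h x hx)
      rw [nhds_prod_eq]
      filter_upwards [(gt_mem_nhds hc).prod_mk hcP] with p hp h0 using hp.2 _ h0 hp.1.le
  obtain ⟨c, hc, hcP⟩ := nhds_basis_closedBall.eventually_iff.1 h'
  exact ⟨c, hc, fun t ht0 htc x hx => hcP (by
    rwa [mem_closedBall, Real.dist_eq, sub_zero, abs_of_pos ht0]) x hx ht0⟩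

section Approx

variable {E : Type*} [NormedAddCommGroup E] [InnerProductSpace ℝ E] [FiniteDimensional ℝ E]

theorem exists_bounded_partition_of_unity :
    ∃ (χ : SmoothPartitionOfUnity ℕ (modelWithCornersSelf ℝ E) E) (C : ℕ → ℝ),
      (∀ k x, χ k x ≠ 0 → x ∈ closedBall (0 : E) (k + 1)) ∧ (∀ k, 0 < C k) ∧
      ∀ k x y, |χ k x - χ k y| ≤ C k * dist x y := by
  obtain ⟨χ, hχ⟩ := SmoothPartitionOfUnity.exists_isSubordinate (modelWithCornersSelf ℝ E)
    (isClosed_univ (X := E)) (fun k : ℕ => ball (0 : E) (k + 1)) (fun k => isOpen_ball)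
    fun x _ => by
      obtain ⟨k, hk⟩ := exists_nat_gt ‖x‖
      exact Set.mem_iUnion.2 ⟨k, by rw [mem_ball_zero_iff]; linarith⟩
  have hsub : ∀ k x, χ k x ≠ 0 → x ∈ closedBall (0 : E) (k + 1) := fun k x hx =>
    ball_subset_closedBall (hχ k (subset_tsupport _ hx))
  have hc : ∀ k, ContDiff ℝ 1 (χ k) := fun k =>
    (contMDiff_iff_contDiff.1 (χ k).contMDiff).of_le (by norm_cast)
  have hs : ∀ k, HasCompactSupport (χ k) := fun k =>
    HasCompactSupport.intro (isCompact_closedBall (0 : E) (k + 1)) fun x hx => by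
      by_contra h
      exact hx (hsub k x h)
  choose C hC hCb using fun k => (hs k).exists_bound_fderiv (hc k)
  refine ⟨χ, C, hsub, hC, fun k x y => ?_⟩
  have := (lipschitzWith_of_nnnorm_fderiv_le (C := ⟨C k, (hC k).le⟩)
    ((hc k).differentiable one_ne_zero) fun x => (hCb k x).2).dist_le_mul x y
  rwa [Real.dist_eq] at this

theorem exists_contDiff_approx {f ε : E → ℝ} (hf : Continuous f) (hε : Continuous ε)
    (hε0 : ∀ x, 0 < ε x) {V : Set E} (hV : IsOpen V) (hfV : tsupport f ⊆ V) :
    ∃ g : E → ℝ, ContDiff ℝ 1 g ∧ (∀ x, |g x - f x| < ε x) ∧ tsupport g ⊆ V ∧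
      ∀ κ : NNReal, LipschitzWith κ f → LipschitzWith (3 * κ) g := by
  obtain ⟨V', hV', hfV', hV'V⟩ := normal_exists_closure_subset (isClosed_tsupport f) hV hfV
  obtain ⟨χ, C, hχ, hC, hχC⟩ := exists_bounded_partition_of_unity (E := E)
  choose c hc hcP using fun k : ℕ =>
    (isCompact_closedBall (0 : E) (k + 1)).exists_pos_forall_of_eventually_prod_nhdsGT
      (P := fun y t => (∀ z ∈ closedBall y t, |f z - f y| < ε y / 2) ∧
        (y ∉ V' → ∀ z ∈ closedBall y t, z ∉ tsupport f))
      fun x _ => (eventually_prod_nhdsGT_abs_sub_lt hf (hε.div_const 2)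
        (fun x => half_pos (hε0 x)) x).and
        (eventually_prod_nhdsGT_disjoint (isClosed_tsupport f) hV' hfV' x)
  obtain ⟨t, ht0, htc, htC⟩ : ∃ t : ℕ → ℝ, (∀ k, 0 < t k) ∧ (∀ k, t k ≤ c k) ∧
      ∀ k, C k * t k ≤ (1 / 2) ^ k :=
    ⟨fun k => min (c k) ((1 / 2) ^ k / C k),
      fun k => lt_min (hc k) (div_pos (by positivity) (hC k)), fun k => min_le_left _ _,
      fun k => (mul_le_mul_of_nonneg_left (min_le_right _ _) (hC k).le).trans_eq
        (mul_div_cancel₀ _ (hC k).ne')⟩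
  choose h hhc hhf hhL using fun k => exists_mollification_s1 hf (ht0 k)
  have hP := fun k => hcP k (t k) (ht0 k) (htc k)
  refine ⟨fun x => ∑ᶠ k, χ k x • h k x, ?_, fun x => ?_, ?_, fun κ hκ => ?_⟩
  · exact contMDiff_iff_contDiff.1
      (χ.contMDiff_finsum_smul fun k x _ => (hhc k).contDiffAt.contMDiffAt)
  · have : ∑ᶠ k, χ k x • h k x ∈ ball (f x) (ε x) :=
      χ.finsum_smul_mem_convex (Set.mem_univ x) (fun k hk => ?_) (convex_ball _ _)
    · rwa [mem_ball, Real.dist_eq] at this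
    · rw [mem_ball, Real.dist_eq]
      have := hhf k x (ε x / 2) fun z hz => ((hP k x (hχ k x hk)).1 z hz).le
      linarith [hε0 x]
  · refine (closure_mono fun x hx => ?_).trans hV'V
    by_contra hxV
    refine hx (finsum_eq_zero_of_forall_eq_zero fun k => ?_)
    by_cases hk : χ k x = 0
    · simp [hk]
    have h0 : ∀ z ∈ closedBall x (t k), f z = 0 := fun z hz =>
      image_eq_zero_of_notMem_tsupport ((hP k x (hχ k x hk)).2 hxV z hz)
    have hx0 := h0 x (mem_closedBall_self (ht0 k).le)
    have := hhf k x 0 fun z hz => by simp [h0 z hz, hx0]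
    rw [hx0, sub_zero] at this
    simp [abs_nonpos_iff.1 this]
  · refine LipschitzWith.of_dist_le_mul fun x y => ?_
    have hfin : ∀ x, {k | χ k x ≠ 0}.Finite := χ.locallyFinite.point_finite
    set s := (hfin x).toFinset ∪ (hfin y).toFinset with hs
    have hsx : ∀ k, χ k x ≠ 0 → k ∈ s := fun k hk => by simp [hs, hk]
    have hsy : ∀ k, χ k y ≠ 0 → k ∈ s := fun k hk => by simp [hs, hk]
    have e1 : ∀ z, (∀ k, χ k z ≠ 0 → k ∈ s) → ∑ k ∈ s, χ k z = 1 := fun z hz => by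
      rw [← χ.sum_eq_one (Set.mem_univ z)]
      exact (finsum_eq_sum_of_support_subset _ hz).symm
    have e2 : ∀ z, (∀ k, χ k z ≠ 0 → k ∈ s) → ∑ᶠ k, χ k z • h k z = ∑ k ∈ s, χ k z * h k z :=
      fun z hz => finsum_eq_sum_of_support_subset _ fun k hk => hz k (left_ne_zero_of_mul hk)
    have e3 : ∑ k ∈ s, χ k x * h k x - ∑ k ∈ s, χ k y * h k y =
        ∑ k ∈ s, χ k x * (h k x - h k y) + ∑ k ∈ s, (χ k x - χ k y) * (h k y - f y) := by
      have : ∑ k ∈ s, (χ k x - χ k y) * f y = 0 := by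
        rw [← Finset.sum_mul, Finset.sum_sub_distrib, e1 x hsx, e1 y hsy, sub_self, zero_mul]
      rw [← Finset.sum_sub_distrib, ← Finset.sum_add_distrib, ← sub_zero (∑ k ∈ s, _),
        ← this, ← Finset.sum_sub_distrib, ← sub_eq_zero, ← Finset.sum_sub_distrib]
      refine Finset.sum_eq_zero fun k _ => ?_
      ring
    have b1 : |∑ k ∈ s, χ k x * (h k x - h k y)| ≤ κ * dist x y := by
      calc _ ≤ ∑ k ∈ s, χ k x * (κ * dist x y) := by
            refine Finset.abs_sum_le_sum_abs _ _ |>.trans (Finset.sum_le_sum fun k _ => ?_)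
            rw [abs_mul, abs_of_nonneg (χ.nonneg k x)]
            exact mul_le_mul_of_nonneg_left ((hhL k κ hκ).dist_le_mul x y) (χ.nonneg k x)
        _ = κ * dist x y := by rw [← Finset.sum_mul, e1 x hsx, one_mul]
    have b2 : |∑ k ∈ s, (χ k x - χ k y) * (h k y - f y)| ≤ 2 * (κ * dist x y) := by
      calc _ ≤ ∑ k ∈ s, (1 / 2) ^ k * (κ * dist x y) := by
            refine Finset.abs_sum_le_sum_abs _ _ |>.trans (Finset.sum_le_sum fun k _ => ?_)
            have : |h k y - f y| ≤ κ * t k := hhf k y _ fun z hz =>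
              (hκ.dist_le_mul z y).trans (mul_le_mul_of_nonneg_left hz κ.2)
            rw [abs_mul]
            calc _ ≤ (C k * dist x y) * (κ * t k) :=
                  mul_le_mul (hχC k x y) this (abs_nonneg _)
                    (mul_nonneg (hC k).le dist_nonneg)
              _ = C k * t k * (κ * dist x y) := by ring
              _ ≤ _ := mul_le_mul_of_nonneg_right (htC k) (by positivity)
        _ ≤ 2 * (κ * dist x y) := by
            rw [← Finset.sum_mul]
            refine mul_le_mul_of_nonneg_right ?_ (by positivity)
            exact (summable_geometric_two.sum_le_tsum s fun k _ => by positivity).trans_eq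
              tsum_geometric_two
    rw [Real.dist_eq, e2 x hsx, e2 y hsy, e3]
    refine (abs_add_le _ _).trans ?_
    push_cast
    linarith

end Approx

section Threshold

variable {E : Type*} [NormedAddCommGroup E] [InnerProductSpace ℝ E] [FiniteDimensional ℝ E]

theorem exists_softThreshold {f ε : E → ℝ} (hf : Continuous f) (hε : Continuous ε)
    (hε0 : ∀ x, 0 < ε x) {V : Set E} (hfV : Function.support f ⊆ V) :
    ∃ g : E → ℝ, Continuous g ∧ (∀ x, |g x - f x| < ε x) ∧ tsupport g ⊆ V ∧
      ∀ κ : NNReal, LipschitzWith κ f → LipschitzWith (2 * κ) g := by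
  by_cases hconst : ∀ x y, f x = f y
  · refine ⟨f, hf, fun x => by simpa using hε0 x, fun x hx => hfV fun h0 => ?_, fun κ hκ =>
      hκ.weaken (le_mul_of_one_le_left κ.2 one_le_two)⟩
    have : f = fun _ => 0 := funext fun y => (hconst y x).trans h0
    simp [tsupport, this] at hx
  push Not at hconst
  obtain ⟨a, b, hab⟩ := hconst
  have hab' : 0 < dist a b := dist_pos.2 fun h => hab (h ▸ rfl)
  have hκ₀ : 0 < dist (f a) (f b) / dist a b := div_pos (dist_pos.2 hab) hab'
  obtain ⟨θ, hθ, hθP, -, hθ1⟩ := exists_contDiff_regulator (E := E) (P := fun y t => t < ε y)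
    isOpen_univ (fun x _ => ⟨ε x / 2, half_pos (hε0 x), by
      filter_upwards [hε.continuousAt.eventually (lt_mem_nhds (half_lt_self (hε0 x)))]
        with y hy t _ ht using ht.trans_lt hy⟩) hκ₀
  have hθ0 : ∀ x, 0 < θ x := fun x => (hθP x trivial).1
  refine ⟨fun x => f x - max (-θ x) (min (f x) (θ x)),
    hf.sub (hθ.continuous.neg.max (hf.min hθ.continuous)), fun x => ?_, ?_, fun κ hκ => ?_⟩
  · have : |max (-θ x) (min (f x) (θ x))| ≤ θ x := abs_le.2
      ⟨le_max_left _ _, max_le (by linarith [hθ0 x]) (min_le_right _ _)⟩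
    rw [sub_sub_cancel_left, abs_neg]
    exact this.trans_lt (hθP x trivial).2
  · refine subset_trans (closure_minimal (t := {x | θ x ≤ |f x|}) (fun x hx => ?_)
      (isClosed_le hθ.continuous hf.abs)) fun x hx => hfV fun h0 => ?_
    · by_contra hlt
      rw [Set.mem_ofPred_eq] at hlt
      obtain ⟨h1, h2⟩ := abs_lt.1 (not_le.1 hlt)
      exact hx (by simp [min_eq_left h2.le, max_eq_right h1.le])
    · have : θ x ≤ |f x| := hx
      rw [h0, abs_zero] at this
      linarith [hθ0 x]
  · have hθκ : LipschitzWith κ θ := lipschitzWith_of_nnnorm_fderiv_le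
      (hθ.differentiable one_ne_zero) fun x => (hθ1 x).trans
        ((div_le_iff₀ hab').2 (hκ.dist_le_mul a b))
    rw [two_mul]
    refine hκ.sub ?_
    simpa using hθκ.neg.max (hκ.min hθκ)

theorem exists_contDiff_approx_of_support_subset {f ε : E → ℝ} (hf : Continuous f)
    (hε : Continuous ε) (hε0 : ∀ x, 0 < ε x) {V : Set E} (hV : IsOpen V)
    (hfV : Function.support f ⊆ V) :
    ∃ g : E → ℝ, ContDiff ℝ 1 g ∧ (∀ x, |f x - g x| < ε x) ∧ tsupport g ⊆ V ∧
      ∀ κ : NNReal, LipschitzWith κ f → LipschitzWith (13 * κ) g := by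
  have hε2 := hε.div_const 2
  have hε20 : ∀ x, 0 < ε x / 2 := fun x => half_pos (hε0 x)
  obtain ⟨f₁, hf₁, hff₁, hf₁V, hf₁L⟩ := exists_softThreshold hf hε2 hε20 hfV
  obtain ⟨g, hg, hgf₁, hgV, hgL⟩ := exists_contDiff_approx hf₁ hε2 hε20 hV hf₁V
  refine ⟨g, hg, fun x => ?_, hgV, fun κ hκ => (hgL _ (hf₁L κ hκ)).weaken ?_⟩
  · have h1 := abs_lt.1 (hff₁ x)
    have h2 := abs_lt.1 (hgf₁ x)
    exact abs_lt.2 ⟨by linarith, by linarith⟩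
  · rw [← mul_assoc]
    gcongr
    norm_num

end Threshold

section Stratification

variable {n : ℕ} {Q : Set (EuclideanSpace ℝ (Fin n))}

theorem CpStratification.dim_lt_of_inter_closure {p : ℕ∞} (A : CpStratification n p Q)
    {L M : Set (EuclideanSpace ℝ (Fin n))} (hL : L ∈ A.strata) (hM : M ∈ A.strata) (hLM : L ≠ M)
    (h : (L ∩ closure M).Nonempty) : A.dim L < A.dim M :=
  A.dim_lt L hL M hM hLM (A.frontierCond L hL M hM hLM h)

theorem CpStratification.exists_approx_on (A : CpStratification n 2 Q) (hQ : IsClosed Q)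
    {f ε : EuclideanSpace ℝ (Fin n) → ℝ} (hf : Continuous f) (hε : Continuous ε)
    (hε0 : ∀ x, 0 < ε x) (hW : WhitneyConditionA A) {V : Set (EuclideanSpace ℝ (Fin n))}
    (hV : IsOpen V) (hfV : Function.support f ⊆ V)
    (s : Finset (Set (EuclideanSpace ℝ (Fin n)))) (hs : s ⊆ A.strata)
    (hdown : ∀ L ∈ A.strata, ∀ M ∈ s, A.dim L < A.dim M → L ∈ s) :
    ∃ g : EuclideanSpace ℝ (Fin n) → ℝ, ContDiff ℝ 1 g ∧ (∀ x, |f x - g x| < ε x) ∧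
      tsupport g ⊆ V ∧ (∀ M ∈ s, ∀ x ∈ M, ∀ u ∈ normalSp n M x, fderiv ℝ g x u = 0) ∧
      ∀ κ : NNReal, LipschitzWith κ f → LipschitzWith (13 ^ (s.card + 1) * κ) g := by
  classical
  induction s using Finset.induction_on_max_value A.dim with
  | empty =>
    obtain ⟨g, hg, hfg, hgV, hgL⟩ := exists_contDiff_approx_of_support_subset hf hε hε0 hV hfV
    exact ⟨g, hg, hfg, hgV, by simp, by simpa using hgL⟩
  | insert M s hMs hmax ih =>
    have hMA : M ∈ A.strata := hs (Finset.mem_insert_self M s)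
    have hsA : s ⊆ A.strata := (Finset.subset_insert M s).trans hs
    have hdown' : ∀ L ∈ A.strata, ∀ N ∈ s, A.dim L < A.dim N → L ∈ s := fun L hL N hN hLN =>
      (Finset.mem_insert.1 (hdown L hL N (Finset.mem_insert_of_mem hN) hLN)).resolve_left
        fun h => absurd (hmax N hN) (by rw [← h]; exact hLN.not_ge)
    obtain ⟨g, hg, hfg, hgV, hgN, hgL⟩ := ih hsA hdown'
    set K := ⋃ L ∈ s, closure L with hKdef
    have hK : IsClosed K := isClosed_biUnion_finset fun L _ => isClosed_closure
    have hne : ∀ L ∈ s, L ≠ M := fun L hL h => hMs (h ▸ hL)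
    have hMK : Disjoint M K := Set.disjoint_left.2 fun x hx hxK => by
      obtain ⟨L, hL, hxL⟩ := Set.mem_iUnion₂.1 hxK
      exact absurd (hmax L hL) (A.dim_lt_of_inter_closure hMA (hsA hL) (hne L hL).symm
        ⟨x, hx, hxL⟩).not_ge
    have hmem : ∀ N ∈ A.strata, (∃ L ∈ insert M s, N ≠ L ∧ (N ∩ closure L).Nonempty) → N ∈ s := by
      rintro N hN ⟨L, hL, hNL, h⟩
      have hlt := A.dim_lt_of_inter_closure hN (hs hL) hNL h
      rcases Finset.mem_insert.1 (hdown N hN L hL hlt) with rfl | h'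
      · rcases Finset.mem_insert.1 hL with rfl | hL'
        · exact absurd rfl hNL
        · exact absurd (hmax L hL') hlt.not_ge
      · exact h'
    have hstratum : ∀ L ∈ A.strata, ∀ x ∈ closure L, ∃ N ∈ A.strata, x ∈ N := fun L hL x hx => by
      have hLQ : L ⊆ Q := A.covers ▸ Set.subset_sUnion_of_mem (Finset.mem_coe.2 hL)
      have hxQ : x ∈ ⋃₀ (A.strata : Set (Set (EuclideanSpace ℝ (Fin n)))) :=
        A.covers.symm ▸ closure_minimal hLQ hQ hx
      exact hxQ
    have hKs : ∀ x ∈ K, ∃ N ∈ s, x ∈ N := fun x hx => by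
      obtain ⟨L, hL, hxL⟩ := Set.mem_iUnion₂.1 hx
      obtain ⟨N, hN, hxN⟩ := hstratum L (hsA hL) x hxL
      by_cases hNL : N = L
      · exact ⟨N, hNL ▸ hL, hxN⟩
      · exact ⟨N, hmem N hN ⟨L, Finset.mem_insert_of_mem hL, hNL, x, hxN, hxL⟩, hxN⟩
    have hcl : closure M ⊆ M ∪ K := fun x hx => by
      obtain ⟨N, hN, hxN⟩ := hstratum M hMA x hx
      by_cases hNM : N = M
      · exact .inl (hNM ▸ hxN)
      · exact .inr (Set.mem_iUnion₂.2 ⟨N, hmem N hN ⟨M, Finset.mem_insert_self M s, hNM, x, hxN, hx⟩,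
          subset_closure hxN⟩)
    have hδ : ∀ x, 0 < ε x - |f x - g x| := fun x => sub_pos.2 (hfg x)
    obtain ⟨g₂, hg₂, hgg₂, hg₂V, hg₂M, hg₂K, hg₂L⟩ := (A.isManifold M hMA).exists_approx_step hK
      hMK hcl hg (hε.sub (hf.sub hg.continuous).abs) hδ hV hgV fun x₀ hx₀ x v v' hxM hx hv hv' => by
        obtain ⟨N, hN, hxN⟩ := hKs x₀ hx₀
        exact hgN N hN x₀ hxN v' (hW M hMA N (hsA hN) x v x₀ v' hxM hxN hx hv hv')
    refine ⟨g₂, hg₂, fun x => ?_, hg₂V, fun N hN x hx u hu => ?_, fun κ hκ => ?_⟩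
    · have h1 : |g₂ x - g x| < ε x - |f x - g x| := hgg₂ x
      have h2 := abs_sub_le (f x) (g x) (g₂ x)
      rw [abs_sub_comm (g x)] at h2
      linarith
    · rcases Finset.mem_insert.1 hN with rfl | hN
      · exact hg₂M x hx u hu
      · rw [hg₂K x (Set.mem_iUnion₂.2 ⟨N, hN, subset_closure hx⟩)]
        exact hgN N hN x hx u hu
    · rw [Finset.card_insert_of_notMem hMs, pow_succ', mul_assoc]
      exact hg₂L _ (hgL κ hκ)

end Stratification

/-- **C¹ approximation on Whitney stratified sets.** -/
theorem approximation_on_whitney_stratified_sets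
    (n m : ℕ) (Q : Set (EuclideanSpace ℝ (Fin n))) (hQ : IsClosed Q)
    (f ε : EuclideanSpace ℝ (Fin n) → ℝ)
    (hf : Continuous f) (hε : Continuous ε) (hε0 : ∀ x, 0 < ε x)
    (A : CpStratification n 2 Q) (hm : A.strata.card = m)
    (hW : WhitneyConditionA A)
    (V₁ : Set (EuclideanSpace ℝ (Fin n))) (hV₁ : IsOpen V₁)
    (hsupp : Function.support f ⊆ V₁) :
    ∃ g : EuclideanSpace ℝ (Fin n) → ℝ,
      ContDiff ℝ 1 g ∧
      (∀ x, |f x - g x| < ε x) ∧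
      (∀ M ∈ A.strata, ∀ x ∈ M, gradient g x ∈ tangentSp n M x) ∧
      (∀ κ : NNReal, LipschitzWith κ f → LipschitzWith (13 ^ (m + 1) * κ) g) ∧
      Function.support g ⊆ V₁ := by
  obtain ⟨g, hg, hfg, hgV, hgN, hgL⟩ := A.exists_approx_on hQ hf hε hε0 hW hV₁ hsupp A.strata
    subset_rfl fun L hL _ _ _ => hL
  refine ⟨g, hg, hfg, fun M hM x hx => ?_, hm ▸ hgL, (subset_tsupport g).trans hgV⟩
  rw [← Submodule.orthogonal_orthogonal (tangentSp n M x), Submodule.mem_orthogonal']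
  intro u hu
  rw [inner_gradient_left]
  exact hgN M hM x hx u hu

end
end
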